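/- arXiv:1506.02126 — 5 statements merged into one kernel-verified Lean document; each statement's English description precedes it below -/
import Mathlib

section
/- There exist δ₀ > 0 and a constant c > 0 (depending only on λ) such that for every g ∈ A^λ(ℝ/2πℤ) and every 0 < δ ≤ δ₀: ‖g‖_{L∞(−π,π)} ≤ c·exp(−λ*(⌊π/δ − 1/2⌋))·‖g‖_{A^λ} + (1/δ)·‖g‖_{L¹(−π,π)}. -/
open scoped Real
open MeasureTheory

/-- The quantity `B_λ = sup {r ≥ 0 | λ(r) < ∞}` (as an extended real number). -/
noncomputable def Blam (lam : ℝ → EReal) : EReal :=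
  sSup {x : EReal | ∃ r : ℝ, 0 ≤ r ∧ lam r ≠ ⊤ ∧ x = (r : EReal)}

/-- The open strip `S_{B_λ} = {z ∈ ℂ | |Im z| < B_λ}`. -/
def stripS (lam : ℝ → EReal) : Set ℂ :=
  {z : ℂ | ((|z.im| : ℝ) : EReal) < Blam lam}

/-- The quantity `exp (-λ*(s))`, where `λ*(s) = sup_{r ≥ 0} (s r - λ(r))` is the Fenchel
conjugate of `λ` (with the convention `exp (-∞) = 0`). -/
noncomputable def expNegLamStar (lam : ℝ → EReal) (s : ℝ) : ℝ :=
  sInf {y : ℝ | ∃ r : ℝ, 0 ≤ r ∧ lam r ≠ ⊤ ∧ y = Real.exp ((lam r).toReal - s * r)}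

theorem coe_lt_Blam_of_lt {lam : ℝ → EReal} {r y : ℝ} (hr : 0 ≤ r) (htop : lam r ≠ ⊤)
    (hy : y < r) : (y : EReal) < Blam lam :=
  lt_of_lt_of_le (EReal.coe_lt_coe_iff.2 hy) (le_sSup ⟨r, hr, htop, rfl⟩)

theorem toReal_lam_le {lam : ℝ → EReal} (hbot : ∀ r, lam r ≠ ⊥)
    (hmono : MonotoneOn lam (Set.Ici 0)) {r t : ℝ} (hr : 0 ≤ r) (hrt : r ≤ t) (ht : lam t ≠ ⊤) :
    (lam r).toReal ≤ (lam t).toReal :=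
  EReal.toReal_le_toReal (hmono hr (hr.trans hrt) hrt) (hbot r) ht

theorem isOpen_stripS (lam : ℝ → EReal) : IsOpen (stripS lam) := by
  refine isOpen_lt ?_ continuous_const
  exact continuous_coe_real_ereal.comp (continuous_abs.comp Complex.continuous_im)

theorem mem_stripS_of_abs_im_le {lam : ℝ → EReal} {z w : ℂ} (hw : w ∈ stripS lam)
    (h : |z.im| ≤ |w.im|) : z ∈ stripS lam :=
  lt_of_le_of_lt (EReal.coe_le_coe_iff.2 h) hw

theorem convex_stripS (lam : ℝ → EReal) : Convex ℝ (stripS lam) := by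
  intro z hz w hw a b ha hb hab
  have him : |(a • z + b • w).im| ≤ max |z.im| |w.im| := by
    simp only [Complex.add_im, Complex.smul_im, smul_eq_mul]
    calc |a * z.im + b * w.im| ≤ a * |z.im| + b * |w.im| := by
          refine (abs_add_le _ _).trans_eq ?_
          rw [abs_mul, abs_mul, abs_of_nonneg ha, abs_of_nonneg hb]
      _ ≤ a * max |z.im| |w.im| + b * max |z.im| |w.im| := by
          gcongr
          · exact le_max_left _ _
          · exact le_max_right _ _
      _ = max |z.im| |w.im| := by rw [← add_mul, hab, one_mul]
  rcases le_total |z.im| |w.im| with h | h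
  · exact mem_stripS_of_abs_im_le hw (him.trans_eq (max_eq_right h))
  · exact mem_stripS_of_abs_im_le hz (him.trans_eq (max_eq_left h))

theorem ofReal_mem_stripS {lam : ℝ → EReal} (hB : 0 < Blam lam) (x : ℝ) :
    (x : ℂ) ∈ stripS lam := by
  simpa [stripS] using hB

theorem periodic_extension {lam : ℝ → EReal} (hB : 0 < Blam lam) {T : ℝ} {g : ℝ → ℂ}
    (hper : ∀ x, g (x + T) = g x) {f : ℂ → ℂ} (hf : DifferentiableOn ℂ f (stripS lam))
    (hfg : ∀ x : ℝ, f x = g x) {z : ℂ} (hz : z ∈ stripS lam) : f (z + T) = f z := by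
  have hmaps : Set.MapsTo (fun z : ℂ => z + T) (stripS lam) (stripS lam) := fun w hw =>
    mem_stripS_of_abs_im_le hw (by simp)
  have hshift : DifferentiableOn ℂ (fun z : ℂ => f (z + T)) (stripS lam) :=
    hf.comp (by fun_prop) hmaps
  refine (hshift.analyticOnNhd (isOpen_stripS lam)).eqOn_of_preconnected_of_frequently_eq
    (hf.analyticOnNhd (isOpen_stripS lam)) (convex_stripS lam).isPreconnected
    (ofReal_mem_stripS hB 0) ?_ hz
  have hreal : Filter.Tendsto (fun x : ℝ => (x : ℂ)) (nhdsWithin 0 {0}ᶜ)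
      (nhdsWithin ((0 : ℝ) : ℂ) {((0 : ℝ) : ℂ)}ᶜ) := by
    refine tendsto_nhdsWithin_iff.2 ⟨?_, ?_⟩
    · exact (Complex.continuous_ofReal.tendsto 0).mono_left nhdsWithin_le_nhds
    · filter_upwards [self_mem_nhdsWithin] with x hx
      simpa using hx
  refine hreal.frequently (Filter.Eventually.frequently (Filter.Eventually.of_forall fun x => ?_))
  have h := hfg (x + T)
  push_cast at h
  rw [h, hper, hfg]

/-- Shifting the contour of a Fourier integral vertically inside the strip. -/
theorem fourier_integral_shift {lam : ℝ → EReal} {f : ℂ → ℂ}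
    (hf : DifferentiableOn ℂ f (stripS lam))
    (hper : ∀ z ∈ stripS lam, f (z + (2 * π : ℝ)) = f z) (k : ℤ) {y : ℝ}
    (hy : ((|y| : ℝ) : EReal) < Blam lam) :
    ∫ x in -π..π, Complex.exp (-(Complex.I * k * x)) * f x =
      ∫ x in -π..π, Complex.exp (-(Complex.I * k * (x + y * Complex.I))) *
        f (x + y * Complex.I) := by
  set F : ℂ → ℂ := fun z => Complex.exp (-(Complex.I * k * z)) * f z with hF
  have hFd : DifferentiableOn ℂ F (stripS lam) := DifferentiableOn.mul (by fun_prop) hf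
  have hmem : ∀ z : ℂ, |z.im| ≤ |y| → z ∈ stripS lam := fun z hz =>
    lt_of_le_of_lt (EReal.coe_le_coe_iff.2 hz) hy
  have hFper : ∀ z ∈ stripS lam, F (z + (2 * π : ℝ)) = F z := by
    intro z hz
    simp only [hF]
    rw [hper z hz]
    congr 1
    refine Complex.exp_eq_exp_iff_exists_int.2 ⟨-k, ?_⟩
    push_cast
    ring
  have hrect := Complex.integral_boundary_rect_eq_zero_of_differentiableOn F
    (-π : ℝ) ((π : ℝ) + (y : ℝ) * Complex.I) (hFd.mono ?_)
  · have hvert : ∀ t ∈ Set.uIcc 0 y,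
        F ((π : ℝ) + t * Complex.I) = F ((-π : ℝ) + t * Complex.I) := by
      intro t ht
      rw [← hFper ((-π : ℝ) + t * Complex.I)]
      · congr 1
        push_cast
        ring
      · refine hmem _ ?_
        have := Set.abs_sub_left_of_mem_uIcc ht
        simpa using this
    simp only [Complex.ofReal_re, Complex.ofReal_im, Complex.add_re, Complex.add_im,
      Complex.mul_re, Complex.mul_im, Complex.I_re, Complex.I_im, mul_zero, mul_one, zero_mul,
      sub_zero, add_zero, zero_add, Complex.ofReal_zero] at hrect
    rw [intervalIntegral.integral_congr hvert, add_sub_cancel_right, sub_eq_zero] at hrect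
    exact hrect
  · intro z hz
    refine hmem z ?_
    have := Set.abs_sub_left_of_mem_uIcc hz.2
    simpa using this

theorem norm_fourier_integral_le {lam : ℝ → EReal} {f : ℂ → ℂ}
    (hf : DifferentiableOn ℂ f (stripS lam))
    (hper : ∀ z ∈ stripS lam, f (z + (2 * π : ℝ)) = f z) {N : ℝ}
    (hN : ∀ z ∈ stripS lam, Real.exp (-(lam |z.im|).toReal) * ‖f z‖ ≤ N) (k : ℤ) {y : ℝ}
    (hy0 : 0 ≤ y) (hy : (y : EReal) < Blam lam) :
    ‖∫ x in -π..π, Complex.exp (-(Complex.I * k * x)) * f x‖ ≤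
      2 * π * (Real.exp ((lam y).toReal - |(k : ℝ)| * y) * N) := by
  obtain ⟨u, hu, hku⟩ : ∃ u : ℝ, |u| = y ∧ (k : ℝ) * u = -(|(k : ℝ)| * y) := by
    rcases le_total 0 (k : ℝ) with hk | hk
    · exact ⟨-y, by rw [abs_neg, abs_of_nonneg hy0], by rw [abs_of_nonneg hk]; ring⟩
    · exact ⟨y, abs_of_nonneg hy0, by rw [abs_of_nonpos hk]; ring⟩
  rw [fourier_integral_shift hf hper k (y := u) (by rwa [hu])]
  have hbound : ∀ x ∈ Set.uIoc (-π) π, ‖Complex.exp (-(Complex.I * k * (x + u * Complex.I))) *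
      f (x + u * Complex.I)‖ ≤ Real.exp ((lam y).toReal - |(k : ℝ)| * y) * N := by
    intro x _
    have hmem : (x + u * Complex.I : ℂ) ∈ stripS lam := by
      simpa [stripS, hu] using hy
    have h := hN _ hmem
    have him : (x + u * Complex.I : ℂ).im = u := by simp
    rw [him, hu] at h
    have hre : (-(Complex.I * k * (x + u * Complex.I))).re = -(|(k : ℝ)| * y) := by
      rw [← hku]
      simp
    rw [norm_mul, Complex.norm_exp, hre, sub_eq_add_neg, Real.exp_add]
    calc Real.exp (-(|(k : ℝ)| * y)) * ‖f (x + u * Complex.I)‖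
        = Real.exp ((lam y).toReal) * Real.exp (-(|(k : ℝ)| * y)) *
            (Real.exp (-(lam y).toReal) * ‖f (x + u * Complex.I)‖) := by
          rw [Real.exp_neg (lam y).toReal]
          field_simp
      _ ≤ _ := by gcongr
  refine (intervalIntegral.norm_integral_le_of_norm_le_const hbound).trans_eq ?_
  rw [sub_neg_eq_add, ← two_mul, abs_of_pos Real.two_pi_pos]
  ring

theorem expNegLamStar_nonneg (lam : ℝ → EReal) (s : ℝ) : 0 ≤ expNegLamStar lam s := by
  refine Real.sInf_nonneg ?_
  rintro _ ⟨r, _, _, rfl⟩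
  positivity

theorem expNegLamStar_le {lam : ℝ → EReal} (s : ℝ) {r : ℝ} (hr : 0 ≤ r) (htop : lam r ≠ ⊤) :
    expNegLamStar lam s ≤ Real.exp ((lam r).toReal - s * r) := by
  refine csInf_le ⟨0, ?_⟩ ⟨r, hr, htop, rfl⟩
  rintro _ ⟨r, _, _, rfl⟩
  positivity

theorem le_expNegLamStar {lam : ℝ → EReal} (hB : 0 < Blam lam) {s b : ℝ}
    (h : ∀ r, 0 ≤ r → lam r ≠ ⊤ → b ≤ Real.exp ((lam r).toReal - s * r)) :
    b ≤ expNegLamStar lam s := by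
  obtain ⟨_, ⟨r, hr, htop, rfl⟩, -⟩ := lt_sSup_iff.1 hB
  refine le_csInf ⟨_, r, hr, htop, rfl⟩ ?_
  rintro _ ⟨t, ht, httop, rfl⟩
  exact h t ht httop

/-- The function `exp (-λ*)` eventually decays at least exponentially. -/
theorem exists_expNegLamStar_add_le {lam : ℝ → EReal} (hbot : ∀ r, lam r ≠ ⊥)
    (hmono : MonotoneOn lam (Set.Ici 0)) (hB : 0 < Blam lam) :
    ∃ ρ s₀ : ℝ, 0 < ρ ∧ 0 ≤ s₀ ∧ ∀ s t : ℝ, s₀ ≤ s → 0 ≤ t →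
      expNegLamStar lam (s + t) ≤ Real.exp (-(ρ * t)) * expNegLamStar lam s := by
  obtain ⟨_, ⟨R, hR, hRtop, rfl⟩, hRpos⟩ := lt_sSup_iff.1 hB
  have hRpos : 0 < R := by exact_mod_cast hRpos
  have hL := toReal_lam_le hbot hmono le_rfl hR hRtop
  have hs₀ : 0 ≤ 2 * ((lam R).toReal - (lam 0).toReal) / R :=
    div_nonneg (by linarith) hR
  refine ⟨R / 2, 2 * ((lam R).toReal - (lam 0).toReal) / R, by positivity, hs₀,
    fun s t hs ht => ?_⟩
  have hs0 : 0 ≤ s := hs₀.trans hs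
  rw [Real.exp_neg, inv_mul_eq_div, le_div_iff₀ (Real.exp_pos _)]
  refine le_expNegLamStar hB fun r hr htop => ?_
  rw [← le_div_iff₀ (Real.exp_pos _), ← Real.exp_sub]
  rcases le_total (R / 2) r with h | h
  · refine (expNegLamStar_le _ hr htop).trans (Real.exp_le_exp.2 ?_)
    nlinarith
  · refine (expNegLamStar_le _ hR hRtop).trans (Real.exp_le_exp.2 ?_)
    have h0 := toReal_lam_le hbot hmono le_rfl hr htop
    rw [div_le_iff₀ hRpos] at hs
    nlinarith [mul_nonneg hs0 (sub_nonneg.2 h), mul_nonneg ht hR]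

theorem norm_fourier_integral_le_expNegLamStar {lam : ℝ → EReal} (hbot : ∀ r, lam r ≠ ⊥)
    (hmono : MonotoneOn lam (Set.Ici 0)) (hB : 0 < Blam lam) {f : ℂ → ℂ}
    (hf : DifferentiableOn ℂ f (stripS lam))
    (hper : ∀ z ∈ stripS lam, f (z + (2 * π : ℝ)) = f z) {N : ℝ} (hN0 : 0 ≤ N)
    (hN : ∀ z ∈ stripS lam, Real.exp (-(lam |z.im|).toReal) * ‖f z‖ ≤ N) (k : ℤ) :
    ‖∫ x in -π..π, Complex.exp (-(Complex.I * k * x)) * f x‖ ≤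
      2 * π * (expNegLamStar lam |(k : ℝ)| * N) := by
  have hr : ∀ r, 0 ≤ r → lam r ≠ ⊤ →
      ‖∫ x in -π..π, Complex.exp (-(Complex.I * k * x)) * f x‖ ≤
        2 * π * (Real.exp ((lam r).toReal - |(k : ℝ)| * r) * N) := by
    intro r hr htop
    rcases hr.eq_or_lt with rfl | hpos
    · exact norm_fourier_integral_le hf hper hN k le_rfl (by exact_mod_cast hB)
    · have hlim : Filter.Tendsto
          (fun y : ℝ => 2 * π * (Real.exp ((lam r).toReal - |(k : ℝ)| * y) * N))
          (nhdsWithin r (Set.Iio r))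
          (nhds (2 * π * (Real.exp ((lam r).toReal - |(k : ℝ)| * r) * N))) :=
        (Continuous.tendsto (by fun_prop) r).mono_left nhdsWithin_le_nhds
      refine ge_of_tendsto hlim ?_
      filter_upwards [Ioo_mem_nhdsLT hpos] with y hy
      refine (norm_fourier_integral_le hf hper hN k hy.1.le
        (coe_lt_Blam_of_lt hr htop hy.2)).trans ?_
      have := toReal_lam_le hbot hmono hy.1.le hy.2.le htop
      gcongr
  rcases hN0.eq_or_lt with rfl | hNpos
  · obtain ⟨_, ⟨r, hr0, htop, rfl⟩, -⟩ := lt_sSup_iff.1 hB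
    simpa using hr r hr0 htop
  · rw [← div_le_iff₀' Real.two_pi_pos, ← div_le_iff₀ hNpos]
    refine le_expNegLamStar hB fun r h0 htop => ?_
    rw [div_le_iff₀ hNpos, div_le_iff₀' Real.two_pi_pos]
    exact hr r h0 htop

theorem hasSum_int_of_const_of_geometric {n : ℕ} {q : ℝ} (hq0 : 0 ≤ q) (hq1 : q < 1) (M C : ℝ) :
    HasSum (fun k : ℤ => if k.natAbs ≤ n then M else C * q ^ (k.natAbs - n))
      ((2 * n + 1) * M + 2 * (q / (1 - q)) * C) := by
  set v : ℕ → ℝ := fun k => if k ≤ n then M else C * q ^ (k - n) with hv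
  have htail : HasSum (fun k => v (k + (n + 1))) (q / (1 - q) * C) := by
    have h := (hasSum_geometric_of_lt_one hq0 hq1).mul_left (C * q)
    convert! h using 1
    · ext k
      have h1 : ¬ k + (n + 1) ≤ n := by omega
      have h2 : k + (n + 1) - n = k + 1 := by omega
      simp only [hv, h1, h2, if_false]
      ring
    · ring
  have hsum : ∑ i ∈ Finset.range (n + 1), v i = (n + 1) * M := by
    rw [Finset.sum_congr rfl (g := fun _ => M)]
    · simp
    · intro i hi
      have : i ≤ n := by simpa [Nat.lt_succ_iff] using hi
      simp [hv, this]
  have hnat : HasSum v (q / (1 - q) * C + (n + 1) * M) := by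
    rw [← hsum]
    exact (hasSum_nat_add_iff (n + 1)).1 htail
  have hsucc : HasSum (fun k => v (k + 1)) (q / (1 - q) * C + n * M) := by
    rw [hasSum_nat_add_iff 1]
    convert! hnat using 1
    simp only [hv, Finset.range_one, Finset.sum_singleton, zero_le, if_true]
    ring
  have := HasSum.of_nat_of_neg_add_one
    (f := fun k : ℤ => if k.natAbs ≤ n then M else C * q ^ (k.natAbs - n))
    (m := q / (1 - q) * C + (n + 1) * M) (m' := q / (1 - q) * C + n * M)
    (by simpa [hv] using hnat) ?_
  · convert! this using 1
    ring
  · convert! hsucc using 2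

/-- A continuous `2π`-periodic function is bounded by any convergent majorant of its Fourier
coefficients. -/
theorem norm_le_of_norm_fourier_integral_le {g : ℝ → ℂ} (hg : Continuous g)
    (hper : ∀ x, g (x + 2 * π) = g x) {u : ℤ → ℝ} {S : ℝ} (hu : HasSum u S)
    (h : ∀ k : ℤ, ‖∫ x in -π..π, Complex.exp (-(Complex.I * k * x)) * g x‖ ≤ 2 * π * u k)
    (x : ℝ) : ‖g x‖ ≤ S := by
  have : Fact (0 < 2 * π) := ⟨Real.two_pi_pos⟩
  have hper' : Function.Periodic g (2 * π) := hper
  let G : C(AddCircle (2 * π), ℂ) := ⟨hper'.lift, continuous_coinduced_dom.2 hg⟩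
  have hGx : ∀ x : ℝ, G (x : AddCircle (2 * π)) = g x := fun x => hper'.lift_coe x
  have hcoeff : ∀ k, ‖fourierCoeff G k‖ ≤ u k := by
    intro k
    rw [fourierCoeff_eq_intervalIntegral G k (-π), show -π + 2 * π = π by ring, norm_smul,
      Real.norm_of_nonneg (by positivity), one_div, inv_mul_le_iff₀ Real.two_pi_pos]
    refine (congrArg norm (intervalIntegral.integral_congr fun x _ => ?_)).trans_le (h k)
    simp only [hGx, smul_eq_mul, fourier_coe_apply]
    congr 2
    have : (π : ℂ) ≠ 0 := by exact_mod_cast Real.pi_ne_zero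
    push_cast
    field_simp
  have hsum : Summable (fourierCoeff G) := Summable.of_norm_bounded hu.summable hcoeff
  have hG := has_pointwise_sum_fourier_series_of_summable hsum (x : AddCircle (2 * π))
  rw [hGx] at hG
  refine hG.norm_le_of_bounded hu fun k => ?_
  rw [norm_smul]
  have hone : ‖fourier k (x : AddCircle (2 * π))‖ = 1 := Circle.norm_coe _
  rw [hone, mul_one]
  exact hcoeff k

theorem norm_fourier_integral_le_integral_norm (g : ℝ → ℂ) (k : ℤ) :
    ‖∫ x in -π..π, Complex.exp (-(Complex.I * k * x)) * g x‖ ≤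
      ∫ y in Set.Ioo (-π) π, ‖g y‖ := by
  have hle : -π ≤ π := by linarith [Real.pi_pos]
  refine (intervalIntegral.norm_integral_le_integral_norm hle).trans_eq ?_
  rw [intervalIntegral.integral_of_le hle, integral_Ioc_eq_integral_Ioo]
  refine integral_congr_ae (Filter.Eventually.of_forall fun x => ?_)
  simp [Complex.norm_exp]

/-- `L^∞`-`L¹` interpolation inequality on the circle for functions in
`A^λ(ℝ/2πℤ)` (Theorem 3.2, part 4): there are `δ₀ > 0` and `c > 0` such that
`‖g‖_{L^∞(-π,π)} ≤ c exp(-λ*(⌊π/δ - 1/2⌋)) ‖g‖_{A^λ} + (1/δ) ‖g‖_{L¹(-π,π)}`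
for all `0 < δ ≤ δ₀`. -/
theorem interpolation_inequality_circle
    (lam : ℝ → EReal) (hlam_bot : ∀ r, lam r ≠ ⊥)
    (hlam_mono : MonotoneOn lam (Set.Ici 0))
    (hBpos : 0 < Blam lam) :
    ∃ (δ₀ c : ℝ), 0 < δ₀ ∧ 0 < c ∧
      ∀ (g : ℝ → ℂ), Continuous g → (∀ x : ℝ, g (x + 2 * π) = g x) →
      ∀ (gext : ℂ → ℂ), DifferentiableOn ℂ gext (stripS lam) → (∀ x : ℝ, gext x = g x) →
      ∀ (Ng : ℝ),
        (∀ z ∈ stripS lam, Real.exp (-(lam |z.im|).toReal) * ‖gext z‖ ≤ Ng) →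
      ∀ (δ : ℝ), 0 < δ → δ ≤ δ₀ →
      ∀ x ∈ Set.Ioo (-π) π,
        ‖g x‖
          ≤ c * expNegLamStar lam ((⌊π / δ - 1 / 2⌋ : ℤ) : ℝ) * Ng
            + (1 / δ) * ∫ y in Set.Ioo (-π) π, ‖g y‖ := by
  obtain ⟨ρ, s₀, hρ, hs₀, hdecay⟩ := exists_expNegLamStar_add_le hlam_bot hlam_mono hBpos
  set q := Real.exp (-ρ) with hq
  have hq0 : 0 < q := Real.exp_pos _
  have hq1 : q < 1 := Real.exp_lt_one_iff.2 (by linarith)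
  refine ⟨π / (s₀ + 5 / 2), 2 * (q / (1 - q)), by positivity,
    mul_pos two_pos (div_pos hq0 (by linarith)), ?_⟩
  intro g hg hper f hf hfg N hN δ hδ hδ₀ x _
  have hN0 : 0 ≤ N := (by positivity : (0 : ℝ) ≤ _).trans (hN _ (ofReal_mem_stripS hBpos 0))
  have hfper : ∀ z ∈ stripS lam, f (z + (2 * π : ℝ)) = f z := fun z hz =>
    periodic_extension hBpos hper hf hfg hz
  have hδ₁ : s₀ + 5 / 2 ≤ π / δ := by
    rw [le_div_iff₀ hδ]
    rwa [le_div_iff₀' (by positivity)] at hδ₀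
  have hfloor := Int.lt_floor_add_one (π / δ - 1 / 2)
  have hfloor' := Int.floor_le (π / δ - 1 / 2)
  obtain ⟨n, hn⟩ : ∃ n : ℕ, ⌊π / δ - 1 / 2⌋ = n :=
    Int.eq_ofNat_of_zero_le (Int.floor_nonneg.2 (by linarith))
  rw [hn] at hfloor hfloor' ⊢
  rw [Int.cast_natCast] at hfloor hfloor' ⊢
  set L := ∫ y in Set.Ioo (-π) π, ‖g y‖
  have hL0 : 0 ≤ L := integral_nonneg fun _ => norm_nonneg _
  have hmain := norm_le_of_norm_fourier_integral_le hg hper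
    (hasSum_int_of_const_of_geometric (n := n) hq0.le hq1 (L / (2 * π))
      (expNegLamStar lam n * N)) ?_ x
  · refine hmain.trans ?_
    have hcoef : (2 * (n : ℝ) + 1) * (L / (2 * π)) ≤ 1 / δ * L := by
      have : (2 * (n : ℝ) + 1) / (2 * π) ≤ 1 / δ := by
        rw [div_le_iff₀ Real.two_pi_pos]
        have : 1 / δ * (2 * π) = 2 * (π / δ) := by ring
        linarith
      calc (2 * (n : ℝ) + 1) * (L / (2 * π)) = (2 * (n : ℝ) + 1) / (2 * π) * L := by ring
        _ ≤ 1 / δ * L := by gcongr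
    linarith
  · intro k
    split_ifs with hk
    · rw [mul_div_cancel₀ _ Real.two_pi_pos.ne']
      exact norm_fourier_integral_le_integral_norm g k
    · have hk : n < k.natAbs := not_le.1 hk
      have h := norm_fourier_integral_le_expNegLamStar hlam_bot hlam_mono hBpos hf hfper hN0 hN k
      simp only [hfg] at h
      refine h.trans ?_
      have habs : |(k : ℝ)| = n + ((k.natAbs - n : ℕ) : ℝ) := by
        rw [Nat.cast_sub hk.le, Nat.cast_natAbs, Int.cast_abs]
        ring
      have hE := hdecay n ((k.natAbs - n : ℕ) : ℝ) (by linarith) (by positivity)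
      have hpow : q ^ (k.natAbs - n) = Real.exp (-(ρ * ((k.natAbs - n : ℕ) : ℝ))) := by
        rw [hq, ← Real.exp_nat_mul]
        congr 1
        ring
      rw [habs, hpow]
      calc 2 * π * (expNegLamStar lam (n + ((k.natAbs - n : ℕ) : ℝ)) * N)
          ≤ 2 * π * (Real.exp (-(ρ * ((k.natAbs - n : ℕ) : ℝ))) * expNegLamStar lam n * N) := by
            gcongr
        _ = _ := by ring
end

section
/- There exist m₀ ∈ ℕ and a constant c_λ > 0 (depending only on λ) such that for every g ∈ A^λ(−1,1) and every m ≥ m₀, the Chebyshev partial sum S_m g := a_0(g)/2 + Σ_{n=1}^{m} a_n(g)·T_n (with T_n the n-th Chebyshev polynomial of the first kind) satisfies ‖g − S_m g‖_{L∞(−1,1)} ≤ c_λ·exp(−λ*(m))·‖g‖_{A^λ(−1,1)}. -/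
open scoped Real

/-- The boundary `∂E_t` of the closed ellipse with foci `±1` and semi-axes
`cosh t`, `sinh t`. -/
def ellipseBoundary (t : ℝ) : Set ℂ :=
  {z : ℂ | z.re ^ 2 / Real.cosh t ^ 2 + z.im ^ 2 / Real.sinh t ^ 2 = 1}

/-- The closed ellipse `E_t` with foci `±1` and semi-axes `cosh t`, `sinh t`. -/
def ellipseClosed (t : ℝ) : Set ℂ :=
  {z : ℂ | z.re ^ 2 / Real.cosh t ^ 2 + z.im ^ 2 / Real.sinh t ^ 2 ≤ 1}

/-- The region `E_{B_λ} = ⋃_{0 < t < B_λ} E_t`. -/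
def ellipseRegion (lam : ℝ → EReal) : Set ℂ :=
  {z : ℂ | ∃ t : ℝ, 0 < t ∧ ((t : ℝ) : EReal) < Blam lam ∧ z ∈ ellipseClosed t}

/-- The `n`-th Chebyshev coefficient `a_n(g) = (2/π) ∫_0^π g(cos θ) cos (nθ) dθ`. -/
noncomputable def chebCoef (g : ℝ → ℝ) (n : ℕ) : ℝ :=
  (2 / π) * ∫ θ in (0 : ℝ)..π, g (Real.cos θ) * Real.cos (n * θ)


open Set

theorem re_cos_add_mul_I (x y : ℝ) :
    (Complex.cos (x + y * Complex.I)).re = Real.cos x * Real.cosh y := by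
  simp [Complex.cos_add_mul_I, Complex.cos_ofReal_re, Complex.cosh_ofReal_re,
    -Complex.ofReal_cos, -Complex.ofReal_cosh]

theorem im_cos_add_mul_I (x y : ℝ) :
    (Complex.cos (x + y * Complex.I)).im = -(Real.sin x * Real.sinh y) := by
  simp [Complex.cos_add_mul_I, Complex.sin_ofReal_re, Complex.sinh_ofReal_re]

theorem mapsTo_cos_ellipseClosed {t : ℝ} (ht : 0 < t) :
    MapsTo Complex.cos {z | |z.im| ≤ t} (ellipseClosed t) := by
  intro z hz
  have hz : |z.im| ≤ t := hz
  have hc := Real.cosh_pos t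
  have hs := Real.sinh_pos_iff.2 ht
  have h1 : Real.cosh z.im ^ 2 ≤ Real.cosh t ^ 2 :=
    pow_le_pow_left₀ (Real.cosh_pos _).le (Real.cosh_le_cosh.2 (hz.trans (le_abs_self t))) 2
  have h2 : Real.sinh z.im ^ 2 ≤ Real.sinh t ^ 2 := by
    linarith [Real.cosh_sq z.im, Real.cosh_sq t]
  change (Complex.cos z).re ^ 2 / _ + (Complex.cos z).im ^ 2 / _ ≤ 1
  rw [← Complex.re_add_im z, re_cos_add_mul_I, im_cos_add_mul_I, neg_sq, mul_pow, mul_pow]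
  have hx : Real.cos z.re ^ 2 * Real.cosh z.im ^ 2 / Real.cosh t ^ 2 ≤ Real.cos z.re ^ 2 := by
    rw [div_le_iff₀ (by positivity)]
    gcongr
  have hy : Real.sin z.re ^ 2 * Real.sinh z.im ^ 2 / Real.sinh t ^ 2 ≤ Real.sin z.re ^ 2 := by
    rw [div_le_iff₀ (by positivity)]
    gcongr
  linarith [Real.cos_sq_add_sin_sq z.re]

theorem cos_add_mul_I_mem_ellipseBoundary {t : ℝ} (ht : 0 < t) (x : ℝ) :
    Complex.cos (x + t * Complex.I) ∈ ellipseBoundary t := by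
  have hc := (Real.cosh_pos t).ne'
  have hs := (Real.sinh_pos_iff.2 ht).ne'
  change (Complex.cos _).re ^ 2 / _ + (Complex.cos _).im ^ 2 / _ = 1
  rw [re_cos_add_mul_I, im_cos_add_mul_I, neg_sq, mul_pow, mul_pow,
    mul_div_cancel_right₀ _ (by positivity), mul_div_cancel_right₀ _ (by positivity),
    Real.cos_sq_add_sin_sq]

/-- The integral of a `2π`-periodic holomorphic function over a period does not change when the
segment of integration is moved vertically. -/
theorem integral_eq_integral_add_mul_I_of_periodic {f : ℂ → ℂ} {t : ℝ} (ht : 0 ≤ t)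
    (hf : DifferentiableOn ℂ f {z | |z.im| ≤ t}) (hper : ∀ z, f (z + 2 * π) = f z) :
    ∫ x in (-π)..π, f x = ∫ x in (-π)..π, f (x + t * Complex.I) := by
  have key := Complex.integral_boundary_rect_eq_zero_of_differentiableOn f (-π : ℝ)
    (π + t * Complex.I) (hf.mono fun z hz => by
      have := hz.2
      simp only [mem_preimage, Complex.ofReal_im, Complex.add_im, Complex.mul_im,
        Complex.ofReal_re, Complex.I_im, Complex.I_re, mul_one, mul_zero, add_zero, zero_add,
        uIcc_of_le ht, mem_Icc] at this
      exact (abs_of_nonneg this.1).trans_le this.2)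
  have hside : ∀ y : ℝ, f (π + y * Complex.I) = f (-π + y * Complex.I) := fun y => by
    rw [← hper (-π + y * Complex.I)]
    ring_nf
  have hre : ((π : ℂ) + t * Complex.I).re = π := by simp
  have him : ((π : ℂ) + t * Complex.I).im = t := by simp
  rw [hre, him, Complex.ofReal_re, Complex.ofReal_im] at key
  simp only [hside, Complex.ofReal_neg, Complex.ofReal_zero, zero_mul, add_zero,
    add_sub_cancel_right] at key
  exact sub_eq_zero.1 key

theorem norm_integral_comp_cos_mul_exp_le {G : ℂ → ℂ} {t M : ℝ} (ht : 0 < t)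
    (hG : DifferentiableOn ℂ G (ellipseClosed t)) (hM : ∀ z ∈ ellipseBoundary t, ‖G z‖ ≤ M)
    (n : ℕ) :
    ‖∫ x in (-π)..π, G (Complex.cos (x : ℝ)) * Complex.exp (n * (x : ℝ) * Complex.I)‖ ≤
      2 * π * (M * Real.exp (-(n * t))) := by
  have hshift := integral_eq_integral_add_mul_I_of_periodic
    (f := fun z => G (Complex.cos z) * Complex.exp (n * z * Complex.I)) ht.le
    ((hG.comp Complex.differentiable_cos.differentiableOn (mapsTo_cos_ellipseClosed ht)).mul
      (by fun_prop))
    (fun z => by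
      have : (n : ℂ) * (z + 2 * π) * Complex.I = n * z * Complex.I + n * (2 * π * Complex.I) := by
        ring
      simp only [Complex.cos_add_two_pi, this, Complex.exp_add, Complex.exp_nat_mul_two_pi_mul_I,
        mul_one])
  rw [hshift]
  refine (intervalIntegral.norm_integral_le_of_norm_le_const
    (C := M * Real.exp (-(n * t))) fun x _ => ?_).trans_eq ?_
  · rw [norm_mul, Complex.norm_exp]
    gcongr
    · exact (norm_nonneg _).trans (hM _ (cos_add_mul_I_mem_ellipseBoundary ht x))
    · exact hM _ (cos_add_mul_I_mem_ellipseBoundary ht x)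
    · simp
  · rw [show π - -π = 2 * π by ring, abs_of_pos Real.two_pi_pos]; ring

theorem integral_comp_cos_mul_exp {G : ℂ → ℂ} {g : ℝ → ℝ}
    (hcont : Continuous fun x : ℝ => G (Complex.cos x))
    (hGg : ∀ x ∈ Ioo (-1 : ℝ) 1, G x = g x) (c : ℝ) :
    ∫ x in (-π)..π, G (Complex.cos (x : ℝ)) * Complex.exp (c * (x : ℝ) * Complex.I) =
      ((2 * ∫ θ in (0 : ℝ)..π, g (Real.cos θ) * Real.cos (c * θ) : ℝ) : ℂ) := by
  set F : ℝ → ℂ := fun x => G (Complex.cos x) * Complex.exp (c * x * Complex.I) with hF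
  have hFc : Continuous F := hcont.mul (by fun_prop)
  have hneg : ∫ x in (-π)..0, F x = ∫ x in (0 : ℝ)..π, F (-x) := by
    rw [intervalIntegral.integral_comp_neg, neg_zero]
  have hFnc : Continuous fun x => F (-x) := hFc.comp continuous_neg
  rw [← intervalIntegral.integral_add_adjacent_intervals (b := 0) (hFc.intervalIntegrable _ _)
    (hFc.intervalIntegrable _ _), hneg, ← intervalIntegral.integral_add
    (hFnc.intervalIntegrable _ _) (hFc.intervalIntegrable _ _),
    ← intervalIntegral.integral_const_mul, ← intervalIntegral.integral_ofReal]
  refine intervalIntegral.integral_congr_Ioo_of_le Real.pi_pos.le fun x hx => ?_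
  have hcos : Real.cos x ∈ Ioo (-1 : ℝ) 1 := by
    constructor
    · rw [← Real.cos_pi]
      exact Real.cos_lt_cos_of_nonneg_of_le_pi hx.1.le le_rfl hx.2
    · rw [← Real.cos_zero]
      exact Real.cos_lt_cos_of_nonneg_of_le_pi le_rfl hx.2.le hx.1
  have hg := hGg _ hcos
  rw [Complex.ofReal_cos] at hg
  simp only [hF, Complex.ofReal_neg, Complex.cos_neg, hg]
  push_cast
  rw [Complex.cos]
  ring_nf

/-- The norm of the Chebyshev coefficients decays geometrically. -/
theorem abs_chebCoef_le {G : ℂ → ℂ} {g : ℝ → ℝ} {t M : ℝ} (ht : 0 < t)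
    (hG : DifferentiableOn ℂ G (ellipseClosed t)) (hM : ∀ z ∈ ellipseBoundary t, ‖G z‖ ≤ M)
    (hcont : Continuous fun x : ℝ => G (Complex.cos x))
    (hGg : ∀ x ∈ Ioo (-1 : ℝ) 1, G x = g x) (n : ℕ) :
    |chebCoef g n| ≤ 2 * M * Real.exp (-t) ^ n := by
  have h := norm_integral_comp_cos_mul_exp_le ht hG hM n
  have h' := integral_comp_cos_mul_exp hcont hGg n
  rw [Complex.ofReal_natCast] at h'
  rw [h', Complex.norm_real, Real.norm_eq_abs] at h
  rw [← Real.exp_nat_mul, mul_neg]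
  have hpi := Real.pi_pos
  have : chebCoef g n = (2 * ∫ θ in (0 : ℝ)..π, g (Real.cos θ) * Real.cos (n * θ)) / π := by
    rw [chebCoef]; ring
  rw [this, abs_div, abs_of_pos hpi, div_le_iff₀ hpi]
  linarith

theorem hasSum_chebCoef_mul_cos {G : ℂ → ℂ} {g : ℝ → ℝ}
    (hcont : Continuous fun x : ℝ => G (Complex.cos x))
    (hGg : ∀ x ∈ Ioo (-1 : ℝ) 1, G x = g x) (hsum : Summable (chebCoef g))
    {θ : ℝ} (hθ : Real.cos θ ∈ Ioo (-1 : ℝ) 1) :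
    HasSum (fun n : ℕ => chebCoef g n * Real.cos (n * θ)) (g (Real.cos θ) + chebCoef g 0 / 2) := by
  have : Fact (0 < 2 * π) := ⟨Real.two_pi_pos⟩
  have hper : Function.Periodic (fun x : ℝ => G (Complex.cos x)) (2 * π) := fun x => by
    simp [Complex.cos_add_two_pi]
  let f : C(AddCircle (2 * π), ℂ) := ⟨hper.lift, hcont.quotient_liftOn' _⟩
  have hf : ∀ x : ℝ, f x = G (Complex.cos x) := fun x => hper.lift_coe x
  have hcoef : ∀ n : ℤ, fourierCoeff f n = ((chebCoef g n.natAbs / 2 : ℝ) : ℂ) := fun n => by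
    have hI := integral_comp_cos_mul_exp hcont hGg (-n : ℝ)
    have hcosn : ∀ x : ℝ, Real.cos (-n * x) = Real.cos (n.natAbs * x) := fun x => by
      rcases Int.natAbs_eq n with h | h <;> rw [h] <;> simp
    simp_rw [hcosn] at hI
    rw [fourierCoeff_eq_intervalIntegral f n (-π), show -π + 2 * π = π by ring]
    have : ∀ x : ℝ, fourier (-n) (x : AddCircle (2 * π)) • f x =
        G (Complex.cos x) * Complex.exp ((-n : ℝ) * x * Complex.I) := fun x => by
      rw [hf, smul_eq_mul, mul_comm, fourier_coe_apply]
      congr 2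
      have := Complex.ofReal_ne_zero.2 Real.pi_ne_zero
      push_cast
      field_simp
    simp_rw [this]
    rw [hI, chebCoef, Complex.real_smul, ← Complex.ofReal_mul]
    congr 1
    field_simp
  have hsummable : Summable (fourierCoeff f) := by
    refine Summable.of_nat_of_neg ?_ ?_ <;>
    · simp only [hcoef, Int.natAbs_neg, Int.natAbs_natCast]
      exact Complex.ofRealCLM.summable (hsum.div_const 2)
  have h := (has_pointwise_sum_fourier_series_of_summable hsummable
    (θ : AddCircle (2 * π))).nat_add_neg
  have hg := hGg _ hθ
  rw [Complex.ofReal_cos] at hg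
  rw [hf, hg] at h
  rw [← Complex.hasSum_ofReal]
  convert h using 1
  · funext n
    simp only [hcoef, Int.natAbs_neg, Int.natAbs_natCast, smul_eq_mul, fourier_coe_apply]
    push_cast
    rw [Complex.cos]
    have := Complex.ofReal_ne_zero.2 Real.pi_ne_zero
    have e1 : 2 * (π : ℂ) * Complex.I * n * θ / (2 * π) = n * θ * Complex.I := by field_simp
    have e2 : 2 * (π : ℂ) * Complex.I * -n * θ / (2 * π) = -(n * θ) * Complex.I := by field_simp
    rw [e1, e2]
    ring
  · simp [hcoef]

/-- Truncation error of the Chebyshev series of a function holomorphic in a single ellipse. -/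
theorem abs_sub_chebyshev_partial_sum_le {G : ℂ → ℂ} {g : ℝ → ℝ} {t M : ℝ} (ht : 0 < t)
    (hG : DifferentiableOn ℂ G (ellipseClosed t)) (hM : ∀ z ∈ ellipseBoundary t, ‖G z‖ ≤ M)
    (hGg : ∀ x ∈ Ioo (-1 : ℝ) 1, G x = g x) (m : ℕ) {x : ℝ} (hx : x ∈ Ioo (-1 : ℝ) 1) :
    |g x - (chebCoef g 0 / 2 +
        ∑ n ∈ Finset.Icc 1 m, chebCoef g n * (Polynomial.Chebyshev.T ℝ (n : ℤ)).eval x)| ≤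
      2 / (Real.exp t - 1) * (Real.exp (-(m * t)) * M) := by
  have hcont : Continuous fun x : ℝ => G (Complex.cos x) := by
    refine (hG.continuousOn).comp_continuous (by fun_prop) fun x => mapsTo_cos_ellipseClosed ht ?_
    simpa using ht.le
  have hr0 := Real.exp_pos (-t)
  have hr1 : Real.exp (-t) < 1 := Real.exp_lt_one_iff.2 (neg_lt_zero.2 ht)
  have hcoef := abs_chebCoef_le ht hG hM hcont hGg
  have hgeom := summable_geometric_of_lt_one hr0.le hr1
  have hsum : Summable (chebCoef g) := .of_norm_bounded (hgeom.mul_left (2 * M)) hcoef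
  obtain ⟨θ, rfl⟩ : ∃ θ, x = Real.cos θ := ⟨_, (Real.cos_arccos hx.1.le hx.2.le).symm⟩
  have h := (hasSum_nat_add_iff' (m + 1)).2 (hasSum_chebCoef_mul_cos hcont hGg hsum hx)
  have htail : g (Real.cos θ) - (chebCoef g 0 / 2 + ∑ n ∈ Finset.Icc 1 m,
        chebCoef g n * (Polynomial.Chebyshev.T ℝ (n : ℤ)).eval (Real.cos θ)) =
      g (Real.cos θ) + chebCoef g 0 / 2 -
        ∑ n ∈ Finset.range (m + 1), chebCoef g n * Real.cos (n * θ) := by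
    rw [Finset.range_eq_Ico, Finset.sum_eq_sum_Ico_succ_bot (Nat.succ_pos m)]
    simp only [Polynomial.Chebyshev.T_real_cos, Int.cast_natCast, CharP.cast_eq_zero, zero_mul,
      Real.cos_zero, mul_one, zero_add]
    rw [show Finset.Ico 1 (m + 1) = Finset.Icc 1 m from rfl]
    ring
  rw [htail, ← h.tsum_eq, ← Real.norm_eq_abs]
  have hb := (hgeom.hasSum.mul_left (2 * M * Real.exp (-t) ^ (m + 1)))
  rw [tsum_geometric_of_lt_one hr0.le hr1] at hb
  refine (tsum_of_norm_bounded hb fun n => ?_).trans_eq ?_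
  · rw [norm_mul, mul_assoc (2 * M), ← pow_add, add_comm (m + 1)]
    exact (mul_le_of_le_one_right (norm_nonneg _) (Real.abs_cos_le_one _)).trans (hcoef _)
  · have he : Real.exp t - 1 ≠ 0 := (sub_pos.2 (Real.one_lt_exp_iff.2 ht)).ne'
    have he' : 1 - Real.exp (-t) ≠ 0 := (sub_pos.2 hr1).ne'
    have hm : Real.exp (-t) * Real.exp t = 1 := by rw [← Real.exp_add]; simp
    rw [show -(m * t) = m * (-t) by ring, Real.exp_nat_mul]
    field_simp
    linear_combination Real.exp (-t) ^ m * M * hm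

theorem lam_ne_top_of_lt_Blam {lam : ℝ → EReal} (hlam_mono : MonotoneOn lam (Ici 0)) {t : ℝ}
    (ht0 : 0 ≤ t) (ht : (t : EReal) < Blam lam) : lam t ≠ ⊤ := by
  obtain ⟨_, ⟨r, hr0, hr, rfl⟩, htr⟩ := lt_sSup_iff.1 ht
  exact ne_top_of_le_ne_top hr (hlam_mono ht0 hr0 (EReal.coe_lt_coe_iff.1 htr).le)

theorem toReal_lam_le_s8 {lam : ℝ → EReal} (hlam_bot : ∀ r, lam r ≠ ⊥)
    (hlam_mono : MonotoneOn lam (Ici 0)) {s t : ℝ} (hs : 0 ≤ s) (hst : s ≤ t)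
    (ht : lam t ≠ ⊤) : (lam s).toReal ≤ (lam t).toReal :=
  EReal.toReal_le_toReal (hlam_mono hs (hs.trans hst) hst) (hlam_bot s) ht

/-- Exponential approximation rate of Chebyshev partial sums for functions in
`A^λ(-1,1)` (Theorem 3.4, part 3): there are `m₀ ∈ ℕ` and `c_λ > 0` such that
`‖g - S_m g‖_{L^∞(-1,1)} ≤ c_λ exp(-λ*(m)) ‖g‖_{A^λ(-1,1)}` for all `m ≥ m₀`. -/
theorem chebyshev_truncation_error
    (lam : ℝ → EReal) (hlam_bot : ∀ r, lam r ≠ ⊥)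
    (hlam_mono : MonotoneOn lam (Set.Ici 0))
    (hBpos : 0 < Blam lam) :
    ∃ (m₀ : ℕ) (c : ℝ), 0 < c ∧
      ∀ (g : ℝ → ℝ), AnalyticOnNhd ℝ g (Set.Ioo (-1 : ℝ) 1) →
      ∀ (gext : ℂ → ℂ), DifferentiableOn ℂ gext (ellipseRegion lam) →
        (∀ x ∈ Set.Ioo (-1 : ℝ) 1, gext x = g x) →
      ∀ (Ng : ℝ),
        (∀ t : ℝ, 0 < t → ((t : ℝ) : EReal) < Blam lam →
          ∀ z ∈ ellipseBoundary t, Real.exp (-(lam t).toReal) * ‖gext z‖ ≤ Ng) →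
      ∀ (m : ℕ), m₀ ≤ m →
      ∀ x ∈ Set.Ioo (-1 : ℝ) 1,
        |g x - (chebCoef g 0 / 2 +
            ∑ n ∈ Finset.Icc 1 m, chebCoef g n * (Polynomial.Chebyshev.T ℝ (n : ℤ)).eval x)|
          ≤ c * expNegLamStar lam m * Ng := by
  obtain ⟨t₀, ht₀, ht₀B⟩ : ∃ t₀ : ℝ, 0 < t₀ ∧ (t₀ : EReal) < Blam lam := by
    obtain ⟨t, h0, hB⟩ := EReal.lt_iff_exists_real_btwn.1 hBpos
    exact ⟨t, by exact_mod_cast h0, hB⟩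
  have hfin := lam_ne_top_of_lt_Blam hlam_mono ht₀.le ht₀B
  obtain ⟨m₀, hm₀⟩ := exists_nat_ge (((lam t₀).toReal - (lam 0).toReal) / (t₀ / 2))
  set δ := t₀ / 2 with hδ
  have hδ0 : 0 < δ := half_pos ht₀
  have hexpδ : 0 < Real.exp δ - 1 := sub_pos.2 (Real.one_lt_exp_iff.2 hδ0)
  refine ⟨m₀, 2 / (Real.exp δ - 1), by positivity, ?_⟩
  intro g _ gext hdiff hext Ng hNg m hm x hx
  have hNg0 : 0 ≤ Ng := (by positivity : (0 : ℝ) ≤ _).trans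
    (hNg t₀ ht₀ ht₀B _ (cos_add_mul_I_mem_ellipseBoundary ht₀ 0))
  set err := |g x - (chebCoef g 0 / 2 +
    ∑ n ∈ Finset.Icc 1 m, chebCoef g n * (Polynomial.Chebyshev.T ℝ (n : ℤ)).eval x)|
  have hsingle : ∀ t : ℝ, δ ≤ t → (t : EReal) < Blam lam →
      err ≤ 2 / (Real.exp δ - 1) * Ng * Real.exp ((lam t).toReal - m * t) := by
    intro t hδt htB
    have ht := hδ0.trans_le hδt
    have h := abs_sub_chebyshev_partial_sum_le ht
      (hdiff.mono fun z hz => ⟨t, ht, htB, hz⟩) (M := Real.exp (lam t).toReal * Ng)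
      (fun z hz => by
        have := hNg t ht htB z hz
        rwa [Real.exp_neg, inv_mul_le_iff₀ (Real.exp_pos _)] at this) hext m hx
    refine h.trans ?_
    rw [sub_eq_add_neg (lam t).toReal, Real.exp_add]
    calc _ ≤ 2 / (Real.exp δ - 1) * (Real.exp (-(m * t)) * (Real.exp (lam t).toReal * Ng)) := by
          gcongr
      _ = _ := by ring
  have hall : ∀ r : ℝ, 0 ≤ r → lam r ≠ ⊤ →
      err ≤ 2 / (Real.exp δ - 1) * Ng * Real.exp ((lam r).toReal - m * r) := by
    intro r hr0 hr
    have hrB : (r : EReal) ≤ Blam lam := le_sSup ⟨r, hr0, hr, rfl⟩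
    rcases le_or_gt r δ with hrδ | hrδ
    · refine (hsingle t₀ (by linarith) ht₀B).trans ?_
      have h0 := toReal_lam_le_s8 hlam_bot hlam_mono le_rfl hr0 hr
      rw [div_le_iff₀ hδ0] at hm₀
      have h1 : (m₀ : ℝ) * δ ≤ m * δ := by gcongr
      have h2 : (m : ℝ) * r ≤ m * δ := by gcongr
      have h3 : (lam t₀).toReal - m * t₀ ≤ (lam r).toReal - m * r := by
        have h4 : m * t₀ = m * δ + m * δ := by ring
        linarith
      exact mul_le_mul_of_nonneg_left (Real.exp_le_exp.2 h3) (by positivity)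
    · have htend : Filter.Tendsto
          (fun t : ℝ => 2 / (Real.exp δ - 1) * Ng * Real.exp ((lam r).toReal - m * t))
          (nhdsWithin r (Iio r))
          (nhds (2 / (Real.exp δ - 1) * Ng * Real.exp ((lam r).toReal - m * r))) :=
        (Continuous.tendsto (by fun_prop) r).mono_left nhdsWithin_le_nhds
      refine ge_of_tendsto htend ?_
      filter_upwards [Ioo_mem_nhdsLT hrδ] with t ht
      refine (hsingle t ht.1.le ((EReal.coe_lt_coe_iff.2 ht.2).trans_le hrB)).trans ?_
      have := toReal_lam_le_s8 hlam_bot hlam_mono (hδ0.trans ht.1).le ht.2.le hr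
      gcongr
  rw [mul_right_comm]
  rcases hNg0.eq_or_lt with rfl | hNgpos
  · simpa using hall t₀ ht₀.le hfin
  · have hc : 0 < 2 / (Real.exp δ - 1) * Ng := by positivity
    rw [← div_le_iff₀' hc]
    refine le_csInf ⟨_, t₀, ht₀.le, hfin, rfl⟩ ?_
    rintro _ ⟨r, hr0, hr, rfl⟩
    rw [div_le_iff₀' hc]
    exact hall r hr0 hr
end

section
/- There exist δ₀ > 0 and a constant c > 0 (depending only on λ) such that for every g ∈ A^λ(−1,1) and every 0 < δ ≤ δ₀: ‖g‖_{L∞(−1,1)} ≤ c·exp(−λ*(⌊√(2/δ)⌋ − 1))·‖g‖_{A^λ(−1,1)} + (1/δ)·‖g‖_{L¹(−1,1)}. -/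
open scoped Real
open MeasureTheory

theorem Real.abs_sin_nat_mul_le (k : ℕ) (x : ℝ) :
    |Real.sin (k * x)| ≤ k * |Real.sin x| := by
  induction k with
  | zero => simp
  | succ k ih =>
    have h : Real.sin ((k + 1 : ℕ) * x) =
        Real.sin (k * x) * Real.cos x + Real.cos (k * x) * Real.sin x := by
      rw [← Real.sin_add]; push_cast; ring_nf
    rw [h]
    refine (abs_add_le _ _).trans ?_
    rw [abs_mul, abs_mul]
    have h1 := Real.abs_cos_le_one x
    have h2 := Real.abs_cos_le_one (k * x)
    have h3 : |Real.sin (k * x)| * |Real.cos x| ≤ |Real.sin (k * x)| :=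
      mul_le_of_le_one_right (abs_nonneg _) h1
    have h4 : |Real.cos (k * x)| * |Real.sin x| ≤ |Real.sin x| :=
      mul_le_of_le_one_left (abs_nonneg _) h2
    push_cast
    linarith

theorem Real.abs_sin_int_mul_le (k : ℤ) (x : ℝ) :
    |Real.sin (k * x)| ≤ |(k : ℝ)| * |Real.sin x| := by
  obtain ⟨n, rfl | rfl⟩ := k.eq_nat_or_neg
  · simpa using Real.abs_sin_nat_mul_le n x
  · simpa using Real.abs_sin_nat_mul_le n x

theorem integral_cos_int_mul (j : ℤ) :
    ∫ θ in (0 : ℝ)..π, Real.cos (j * θ) = if j = 0 then π else 0 := by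
  split_ifs with h
  · simp [h]
  · have hj : (j : ℝ) ≠ 0 := by exact_mod_cast h
    rw [intervalIntegral.integral_comp_mul_left _ hj]
    simp [Real.sin_int_mul_pi]

theorem integral_cos_mul_sin_mul_sin (n k : ℤ) :
    ∫ θ in (0 : ℝ)..π, Real.cos (n * θ) * (Real.sin (k * θ) * Real.sin θ) =
      π / 4 * ((if k = n + 1 then 1 else 0) + (if k = -(n - 1) then 1 else 0)
        - (if k = n - 1 then 1 else 0) - (if k = -(n + 1) then 1 else 0)) := by
  have h : ∀ θ : ℝ, Real.cos (n * θ) * (Real.sin (k * θ) * Real.sin θ) =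
      1 / 4 * (Real.cos ((n - k + 1 : ℤ) * θ) + Real.cos ((n + k - 1 : ℤ) * θ)
        - Real.cos ((n - k - 1 : ℤ) * θ) - Real.cos ((n + k + 1 : ℤ) * θ)) := by
    intro θ
    have e1 : ((n - k + 1 : ℤ) : ℝ) * θ = (n * θ - k * θ) + θ := by push_cast; ring
    have e2 : ((n + k - 1 : ℤ) : ℝ) * θ = (n * θ + k * θ) - θ := by push_cast; ring
    have e3 : ((n - k - 1 : ℤ) : ℝ) * θ = (n * θ - k * θ) - θ := by push_cast; ring
    have e4 : ((n + k + 1 : ℤ) : ℝ) * θ = (n * θ + k * θ) + θ := by push_cast; ring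
    rw [e1, e2, e3, e4]
    simp only [Real.cos_add, Real.cos_sub, Real.sin_add, Real.sin_sub]
    ring
  have hc : ∀ j : ℤ, IntervalIntegrable (fun θ : ℝ => Real.cos (j * θ)) volume 0 π :=
    fun j => (by fun_prop : Continuous fun θ : ℝ => Real.cos (j * θ)).intervalIntegrable _ _
  simp_rw [h]
  rw [intervalIntegral.integral_const_mul, intervalIntegral.integral_sub
    (((hc _).add (hc _)).sub (hc _)) (hc _), intervalIntegral.integral_sub
    ((hc _).add (hc _)) (hc _), intervalIntegral.integral_add (hc _) (hc _)]
  simp only [integral_cos_int_mul]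
  have i1 : n - k + 1 = 0 ↔ k = n + 1 := by omega
  have i2 : n + k - 1 = 0 ↔ k = -(n - 1) := by omega
  have i3 : n - k - 1 = 0 ↔ k = n - 1 := by omega
  have i4 : n + k + 1 = 0 ↔ k = -(n + 1) := by omega
  simp only [i1, i2, i3, i4]
  have hm : ∀ (p : Prop) [Decidable p], (if p then π else 0) = π * (if p then (1:ℝ) else 0) := by
    intro p _; split_ifs <;> simp
  simp only [hm]
  ring

/-- For an odd sequence `a` supported in `[-P, P]`, the Chebyshev moments of the sine sum
`∑ a k sin (k θ)`. -/
theorem integral_cos_mul_sineSum (a : ℤ → ℝ) (P : ℕ) (hodd : ∀ k, a (-k) = -a k)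
    (hsupp : ∀ k : ℤ, (P : ℤ) < |k| → a k = 0) (n : ℤ) :
    ∫ θ in (0 : ℝ)..π, Real.cos (n * θ) *
        ((∑ k ∈ Finset.Icc (-P : ℤ) P, a k * Real.sin (k * θ)) * Real.sin θ) =
      π / 2 * (a (n + 1) - a (n - 1)) := by
  have h : ∀ θ : ℝ, Real.cos (n * θ) *
        ((∑ k ∈ Finset.Icc (-P : ℤ) P, a k * Real.sin (k * θ)) * Real.sin θ) =
      ∑ k ∈ Finset.Icc (-P : ℤ) P,
        a k * (Real.cos (n * θ) * (Real.sin (k * θ) * Real.sin θ)) := by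
    intro θ
    rw [Finset.sum_mul, Finset.mul_sum]
    exact Finset.sum_congr rfl fun k _ => by ring
  have hs : ∀ j : ℤ, ∑ k ∈ Finset.Icc (-P : ℤ) P, a k * (if k = j then 1 else 0) = a j := by
    intro j
    simp only [mul_ite, mul_one, mul_zero, Finset.sum_ite_eq', Finset.mem_Icc]
    split_ifs with hj
    · rfl
    · refine (hsupp j ?_).symm
      rw [← abs_le] at hj
      exact not_le.mp hj
  simp_rw [h]
  rw [intervalIntegral.integral_finsetSum]
  · simp_rw [intervalIntegral.integral_const_mul, integral_cos_mul_sin_mul_sin]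
    have h2 : ∀ k : ℤ, a k * (π / 4 * ((if k = n + 1 then 1 else 0)
        + (if k = -(n - 1) then 1 else 0)
        - (if k = n - 1 then 1 else 0) - (if k = -(n + 1) then 1 else 0))) =
        π / 4 * (a k * (if k = n + 1 then 1 else 0) + a k * (if k = -(n - 1) then 1 else 0)
        - a k * (if k = n - 1 then 1 else 0) - a k * (if k = -(n + 1) then 1 else 0)) := by
      intro k; ring
    simp_rw [h2]
    rw [← Finset.mul_sum, Finset.sum_sub_distrib, Finset.sum_sub_distrib,
      Finset.sum_add_distrib, hs, hs, hs, hs, hodd, hodd]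
    ring
  · intro k _
    exact Continuous.intervalIntegrable (by fun_prop) _ _

theorem sum_abs_Icc_neg (P : ℕ) :
    ∑ k ∈ Finset.Icc (-P : ℤ) P, |(k : ℝ)| = P * (P + 1) := by
  rw [Finset.sum_Icc_of_even_eq_range (f := fun k : ℤ => |(k : ℝ)|) (by intro k; simp) P]
  simp only [Int.cast_natCast, Nat.abs_cast, Int.cast_zero, abs_zero, sub_zero]
  induction P with
  | zero => simp
  | succ P ih =>
    rw [Finset.sum_range_succ, smul_add, ih]
    push_cast; simp; ring

/-- The cutoff equal to `1` on `[-K, K]`, vanishing outside `[-K - m, K + m]` and affine in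
between. -/
noncomputable def trapezoidCutoff (K m : ℕ) (k : ℤ) : ℝ :=
  max 0 (min 1 ((K + m - |(k : ℝ)|) / m))

theorem trapezoidCutoff_nonneg (K m : ℕ) (k : ℤ) : 0 ≤ trapezoidCutoff K m k :=
  le_max_left _ _

theorem trapezoidCutoff_le_one (K m : ℕ) (k : ℤ) : trapezoidCutoff K m k ≤ 1 :=
  max_le zero_le_one (min_le_left _ _)

theorem trapezoidCutoff_eq_one {K m : ℕ} (hm : 0 < m) {k : ℤ} (hk : |k| ≤ K) :
    trapezoidCutoff K m k = 1 := by
  have hm' : (0 : ℝ) < m := by exact_mod_cast hm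
  have hk' : |(k : ℝ)| ≤ K := by exact_mod_cast hk
  have : 1 ≤ (K + m - |(k : ℝ)|) / m := by rw [le_div_iff₀ hm']; linarith
  rw [trapezoidCutoff, min_eq_left this, max_eq_right zero_le_one]

theorem trapezoidCutoff_eq_zero {K m : ℕ} {k : ℤ} (hk : ((K + m : ℕ) : ℤ) ≤ |k|) :
    trapezoidCutoff K m k = 0 := by
  have hk' : (K : ℝ) + m ≤ |(k : ℝ)| := by exact_mod_cast hk
  exact max_eq_left ((min_le_right _ _).trans
    (div_nonpos_of_nonpos_of_nonneg (by linarith) (Nat.cast_nonneg _)))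

theorem abs_trapezoidCutoff_sub_le (K m : ℕ) (k l : ℤ) :
    |trapezoidCutoff K m k - trapezoidCutoff K m l| ≤ |(k : ℝ) - l| / m := by
  unfold trapezoidCutoff
  refine (abs_max_sub_max_le_max _ _ _ _).trans (max_le (by simp; positivity) ?_)
  refine (abs_min_sub_min_le_max _ _ _ _).trans (max_le (by simp; positivity) ?_)
  rw [← sub_div, abs_div, Nat.abs_cast]
  refine div_le_div_of_nonneg_right ?_ (Nat.cast_nonneg _)
  calc |(K + m - |(k : ℝ)|) - (K + m - |(l : ℝ)|)| = abs (|(l : ℝ)| - |(k : ℝ)|) := by ring_nf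
    _ ≤ |(l : ℝ) - k| := abs_abs_sub_abs_le_abs_sub _ _
    _ = |(k : ℝ) - l| := abs_sub_comm _ _

/-- A bounded kernel reproducing `cos (n θ)` for `|n| < K` against `sin θ dθ`, with uniformly
bounded error on all other frequencies. -/
theorem exists_cosine_reproducing_kernel (K : ℕ) (hK : 4 ≤ K) (θ₀ : ℝ)
    (hθ₀ : 0 < Real.sin θ₀) :
    ∃ Φ : ℝ → ℝ, Continuous Φ ∧ (∀ θ, |Φ θ| ≤ ((K : ℝ) + 1) ^ 2 / 2) ∧
      ∀ n : ℤ, |Real.cos (n * θ₀) -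
        ∫ θ in (0 : ℝ)..π, Real.cos (n * θ) * (Φ θ * Real.sin θ)| ≤
          if (K : ℤ) ≤ |n| then 10 else 0 := by
  obtain ⟨m, hm, hm1, hm2⟩ : ∃ m : ℕ, 0 < m ∧ 4 * m ≤ K ∧ K ≤ 7 * m :=
    ⟨K / 4, by omega, by omega, by omega⟩
  have hmR : (0 : ℝ) < m := by exact_mod_cast hm
  have hm1R : 4 * (m : ℝ) ≤ K := by exact_mod_cast hm1
  have hm2R : (K : ℝ) ≤ 7 * m := by exact_mod_cast hm2
  set c := trapezoidCutoff K m with hc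
  set a : ℤ → ℝ := fun k => c k * Real.sin (k * θ₀) with ha
  set S : ℝ → ℝ := fun θ => ∑ k ∈ Finset.Icc (-(K + m : ℕ) : ℤ) (K + m : ℕ),
    a k * Real.sin (k * θ) with hS
  have hmom : ∀ n : ℤ, ∫ θ in (0 : ℝ)..π, Real.cos (n * θ) * (S θ * Real.sin θ) =
      π / 2 * (a (n + 1) - a (n - 1)) := by
    refine integral_cos_mul_sineSum a (K + m) (fun k => ?_) (fun k hk => ?_)
    · simp [ha, hc, trapezoidCutoff]
    · simp only [ha, hc, trapezoidCutoff_eq_zero hk.le, zero_mul]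
  have hSb : ∀ θ, |S θ| ≤ Real.sin θ₀ * ((K + m : ℕ) * ((K + m : ℕ) + 1)) := by
    intro θ
    rw [← sum_abs_Icc_neg, Finset.mul_sum]
    refine (Finset.abs_sum_le_sum_abs _ _).trans (Finset.sum_le_sum fun k _ => ?_)
    rw [abs_mul, abs_mul, abs_of_nonneg (trapezoidCutoff_nonneg K m k)]
    have h1 := Real.abs_sin_int_mul_le k θ₀
    rw [abs_of_pos hθ₀] at h1
    have h2 := Real.abs_sin_le_one (k * θ)
    have h3 := trapezoidCutoff_le_one K m k
    calc c k * |Real.sin (k * θ₀)| * |Real.sin (k * θ)|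
        ≤ 1 * (|(k : ℝ)| * Real.sin θ₀) * 1 := by gcongr
      _ = _ := by ring
  refine ⟨fun θ => S θ / (π * Real.sin θ₀), by fun_prop, fun θ => ?_, fun n => ?_⟩
  · rw [abs_div, abs_of_pos (by positivity : 0 < π * Real.sin θ₀), div_le_iff₀ (by positivity)]
    refine (hSb θ).trans ?_
    have hpi := Real.pi_gt_d4
    have hK' : (4 : ℝ) ≤ K := by exact_mod_cast hK
    have h1 : (((K + m : ℕ) : ℝ) * ((K + m : ℕ) + 1)) ≤ (5 / 4 * K) * (5 / 4 * K + 1) := by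
      push_cast; gcongr <;> linarith
    have h2 : (5 / 4 * (K : ℝ)) * (5 / 4 * K + 1) ≤ (K + 1) ^ 2 / 2 * π := by nlinarith
    calc _ ≤ Real.sin θ₀ * ((K + 1) ^ 2 / 2 * π) := mul_le_mul_of_nonneg_left (h1.trans h2) hθ₀.le
      _ = _ := by ring
  · have hI : ∫ θ in (0 : ℝ)..π, Real.cos (n * θ) *
        (S θ / (π * Real.sin θ₀) * Real.sin θ) =
        (a (n + 1) - a (n - 1)) / (2 * Real.sin θ₀) := by
      have : ∀ θ, Real.cos (n * θ) * (S θ / (π * Real.sin θ₀) * Real.sin θ) =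
          (π * Real.sin θ₀)⁻¹ * (Real.cos (n * θ) * (S θ * Real.sin θ)) := by
        intro θ; field_simp
      simp_rw [this]
      rw [intervalIntegral.integral_const_mul, hmom]
      have := Real.pi_pos
      field_simp
    have hsplit : (a (n + 1) - a (n - 1)) / (2 * Real.sin θ₀) =
        (c (n + 1) - c (n - 1)) / 2 * (Real.sin (n * θ₀) / Real.sin θ₀) * Real.cos θ₀
          + (c (n + 1) + c (n - 1)) / 2 * Real.cos (n * θ₀) := by
      simp only [ha]
      push_cast
      rw [add_mul, sub_mul, one_mul, Real.sin_add, Real.sin_sub]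
      field_simp
      ring
    rw [hI, hsplit]
    split_ifs with hn
    · have hA : |(c (n + 1) - c (n - 1)) / 2 * (Real.sin (n * θ₀) / Real.sin θ₀) *
          Real.cos θ₀| ≤ 8 := by
        have hs : |Real.sin (n * θ₀) / Real.sin θ₀| ≤ |(n : ℝ)| := by
          rw [abs_div, div_le_iff₀ (abs_pos.mpr hθ₀.ne')]
          exact Real.abs_sin_int_mul_le n θ₀
        have hcs := Real.abs_cos_le_one θ₀
        have hd : |(c (n + 1) - c (n - 1)) / 2| * |(n : ℝ)| ≤ 8 := by
          by_cases hnP : ((K + m : ℕ) : ℤ) < |n|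
          · have e1 : c (n + 1) = 0 := trapezoidCutoff_eq_zero (by
              rcases abs_cases n with h | h <;> rcases abs_cases (n + 1) with h' | h' <;> omega)
            have e2 : c (n - 1) = 0 := trapezoidCutoff_eq_zero (by
              rcases abs_cases n with h | h <;> rcases abs_cases (n - 1) with h' | h' <;> omega)
            simp [e1, e2]
          · have hn' : |(n : ℝ)| ≤ K + m := by exact_mod_cast not_lt.mp hnP
            have hl := abs_trapezoidCutoff_sub_le K m (n + 1) (n - 1)
            have e : |((n + 1 : ℤ) : ℝ) - ((n - 1 : ℤ) : ℝ)| = 2 := by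
              push_cast; ring_nf; norm_num
            rw [e] at hl
            have hl' : |(c (n + 1) - c (n - 1)) / 2| ≤ 1 / m := by
              rw [abs_div, abs_two]
              calc _ ≤ (2 / (m : ℝ)) / 2 := by gcongr
                _ = _ := by ring
            calc _ ≤ 1 / (m : ℝ) * (8 * m) := by gcongr; linarith
              _ = 8 := by field_simp
        rw [abs_mul, abs_mul]
        calc _ ≤ |(c (n + 1) - c (n - 1)) / 2| * |(n : ℝ)| * 1 := by gcongr
          _ ≤ 8 := by linarith
      have hB : |(c (n + 1) + c (n - 1)) / 2 * Real.cos (n * θ₀)| ≤ 1 := by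
        have h1 := trapezoidCutoff_nonneg K m (n + 1)
        have h2 := trapezoidCutoff_nonneg K m (n - 1)
        have h3 := trapezoidCutoff_le_one K m (n + 1)
        have h4 := trapezoidCutoff_le_one K m (n - 1)
        rw [abs_mul]
        refine mul_le_one₀ ?_ (abs_nonneg _) (Real.abs_cos_le_one _)
        rw [abs_le]; constructor <;> linarith
      have hC := Real.abs_cos_le_one (n * θ₀)
      rw [abs_le] at hA hB hC ⊢
      constructor <;> linarith
    · have e1 : c (n + 1) = 1 := trapezoidCutoff_eq_one hm (by
        rcases abs_cases n with h | h <;> rcases abs_cases (n + 1) with h' | h' <;> omega)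
      have e2 : c (n - 1) = 1 := trapezoidCutoff_eq_one hm (by
        rcases abs_cases n with h | h <;> rcases abs_cases (n - 1) with h' | h' <;> omega)
      simp [e1, e2]

theorem joukowski_re_im {w : ℂ} {r : ℝ} (hw : ‖w‖ = Real.exp r) :
    ((w + w⁻¹) / 2).re = Real.cosh r * (w.re / ‖w‖) ∧
      ((w + w⁻¹) / 2).im = Real.sinh r * (w.im / ‖w‖) := by
  have hpos := Real.exp_pos r
  have hn : Complex.normSq w = Real.exp r ^ 2 := by rw [Complex.normSq_eq_norm_sq, hw]
  constructor
  · rw [Complex.div_ofNat_re, Complex.add_re, Complex.inv_re, hn, hw, Real.cosh_eq, Real.exp_neg]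
    field_simp
  · rw [Complex.div_ofNat_im, Complex.add_im, Complex.inv_im, hn, hw, Real.sinh_eq, Real.exp_neg]
    field_simp
    ring

theorem re_div_norm_sq_add_im_div_norm_sq {w : ℂ} (hw : w ≠ 0) :
    (w.re / ‖w‖) ^ 2 + (w.im / ‖w‖) ^ 2 = 1 := by
  have h : ‖w‖ ^ 2 = w.re ^ 2 + w.im ^ 2 := by
    rw [← Complex.normSq_eq_norm_sq, Complex.normSq_apply]; ring
  have : ‖w‖ ≠ 0 := norm_ne_zero_iff.mpr hw
  field_simp
  rw [h]

theorem joukowski_mem_ellipseClosed {w : ℂ} {s : ℝ} (hs : 0 < s)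
    (h1 : Real.exp (-s) ≤ ‖w‖) (h2 : ‖w‖ ≤ Real.exp s) :
    (w + w⁻¹) / 2 ∈ ellipseClosed s := by
  have hw0 : 0 < ‖w‖ := (Real.exp_pos _).trans_le h1
  obtain ⟨r, hr⟩ : ∃ r, ‖w‖ = Real.exp r := ⟨Real.log ‖w‖, (Real.exp_log hw0).symm⟩
  have hrs : |r| ≤ |s| := by
    rw [abs_of_pos hs, abs_le]
    rw [hr, Real.exp_le_exp] at h1 h2
    exact ⟨h1, h2⟩
  have hc : Real.cosh r ^ 2 ≤ Real.cosh s ^ 2 := by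
    have := Real.cosh_le_cosh.mpr hrs
    have := Real.cosh_pos r
    gcongr
  have hsh : Real.sinh r ^ 2 ≤ Real.sinh s ^ 2 := by
    rw [Real.sinh_sq, Real.sinh_sq]; linarith
  have hsp : 0 < Real.sinh s := Real.sinh_pos_iff.mpr hs
  have hcp := Real.cosh_pos s
  have hone := re_div_norm_sq_add_im_div_norm_sq (norm_pos_iff.mp hw0)
  obtain ⟨e1, e2⟩ := joukowski_re_im hr
  simp only [ellipseClosed, Set.mem_ofPred_eq]
  rw [e1, e2, mul_pow, mul_pow, ← hone]
  gcongr
  · rw [div_le_iff₀ (by positivity), mul_comm]; gcongr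
  · rw [div_le_iff₀ (by positivity), mul_comm]; gcongr

theorem joukowski_mem_ellipseBoundary {w : ℂ} {s : ℝ} (hs : 0 < s)
    (h : ‖w‖ = Real.exp s ∨ ‖w‖ = Real.exp (-s)) :
    (w + w⁻¹) / 2 ∈ ellipseBoundary s := by
  have hw0 : w ≠ 0 := by
    rw [← norm_pos_iff]
    rcases h with h | h <;> rw [h] <;> exact Real.exp_pos _
  have hsp : 0 < Real.sinh s := Real.sinh_pos_iff.mpr hs
  have hcp := Real.cosh_pos s
  have hone := re_div_norm_sq_add_im_div_norm_sq hw0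
  simp only [ellipseBoundary, Set.mem_ofPred_eq]
  rcases h with h | h
  · obtain ⟨e1, e2⟩ := joukowski_re_im h
    rw [e1, e2, mul_pow, mul_pow, ← hone]
    field_simp
  · obtain ⟨e1, e2⟩ := joukowski_re_im h
    rw [e1, e2, Real.cosh_neg, Real.sinh_neg, mul_pow, mul_pow, neg_sq, ← hone]
    field_simp

/-- Laurent coefficient bounds on a symmetric annulus. -/
theorem norm_laurent_coeff_le {G : ℂ → ℂ} {s s' M : ℝ} (hs : 0 < s) (hs' : s < s')
    (hG : DifferentiableOn ℂ G {w | Real.exp (-s') < ‖w‖ ∧ ‖w‖ < Real.exp s'})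
    (hM : ∀ w : ℂ, ‖w‖ = Real.exp s ∨ ‖w‖ = Real.exp (-s) → ‖G w‖ ≤ M) (n : ℤ) :
    ‖(2 * π * Complex.I : ℂ)⁻¹ • ∮ w in C(0, 1), w⁻¹ • (w ^ (-n) * G w)‖ ≤
      M * Real.exp (-s) ^ n.natAbs := by
  have hopen : IsOpen {w : ℂ | Real.exp (-s') < ‖w‖ ∧ ‖w‖ < Real.exp s'} :=
    (isOpen_lt continuous_const continuous_norm).inter
      (isOpen_lt continuous_norm continuous_const)
  have hd : ∀ w : ℂ, Real.exp (-s) ≤ ‖w‖ → ‖w‖ ≤ Real.exp s →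
      DifferentiableAt ℂ (fun w => w ^ (-n) * G w) w := by
    intro w h1 h2
    have hw0 : w ≠ 0 := norm_pos_iff.mp ((Real.exp_pos _).trans_le h1)
    have hGw : DifferentiableAt ℂ G w := hG.differentiableAt (hopen.mem_nhds
      ⟨(Real.exp_lt_exp.mpr (by linarith)).trans_le h1,
        h2.trans_lt (Real.exp_lt_exp.mpr hs')⟩)
    exact (differentiableAt_zpow.mpr (Or.inl hw0)).mul hGw
  have hes : 1 < Real.exp s := Real.one_lt_exp_iff.mpr hs
  have hes' : Real.exp (-s) < 1 := Real.exp_lt_one_iff.mpr (by linarith)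
  have hmove : ∀ r R : ℝ, 0 < r → r ≤ R → Real.exp (-s) ≤ r → R ≤ Real.exp s →
      (∮ w in C(0, R), w⁻¹ • (w ^ (-n) * G w)) = ∮ w in C(0, r), w⁻¹ • (w ^ (-n) * G w) := by
    intro r R hr hrR h1 h2
    have := Complex.circleIntegral_sub_center_inv_smul_eq_of_differentiable_on_annulus_off_countable
      (c := 0) hr hrR (f := fun w => w ^ (-n) * G w) Set.countable_empty
      (fun w hw => (hd w (h1.trans ?_) (le_trans ?_ h2)).continuousAt.continuousWithinAt)
      (fun w hw => hd w (h1.trans ?_) (le_trans ?_ h2))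
    · simpa using this
    all_goals simp at hw
    · exact hw.2
    · exact hw.1
    · exact hw.2.le
    · exact hw.1.le
  have hbound : ∀ R : ℝ, 0 < R → (R = Real.exp s ∨ R = Real.exp (-s)) →
      ‖(2 * π * Complex.I : ℂ)⁻¹ • ∮ w in C(0, R), w⁻¹ • (w ^ (-n) * G w)‖ ≤
        R * (R⁻¹ * (R ^ (-n) * M)) := by
    intro R hR h
    refine circleIntegral.norm_two_pi_i_inv_smul_integral_le_of_norm_le_const hR.le fun w hw => ?_
    have hw' : ‖w‖ = R := by simpa using hw
    rw [norm_smul, norm_mul, norm_inv, norm_zpow, hw']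
    gcongr
    exact hM w (by rwa [hw'])
  rcases le_total 0 n with hn | hn
  · lift n to ℕ using hn
    rw [← hmove 1 (Real.exp s) one_pos hes.le hes'.le le_rfl]
    refine (hbound _ (Real.exp_pos s) (Or.inl rfl)).trans (le_of_eq ?_)
    have := (Real.exp_pos s).ne'
    rw [Real.exp_neg, zpow_neg, zpow_natCast, Int.natAbs_natCast, inv_pow]
    field_simp
  · obtain ⟨k, rfl⟩ : ∃ k : ℕ, n = -k := ⟨n.natAbs, by omega⟩
    rw [hmove (Real.exp (-s)) 1 (Real.exp_pos _) hes'.le le_rfl hes.le]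
    refine (hbound _ (Real.exp_pos _) (Or.inr rfl)).trans (le_of_eq ?_)
    have := (Real.exp_pos (-s)).ne'
    rw [neg_neg, zpow_natCast, Int.natAbs_neg, Int.natAbs_natCast]
    field_simp

/-- Fourier expansion of `θ ↦ G (cos θ)` for `G` holomorphic in an ellipse: after averaging over
`θ ↦ -θ` it becomes a cosine series with geometrically decaying coefficients. -/
theorem exists_cosine_series {F : ℂ → ℂ} {s s' M : ℝ} (hs : 0 < s) (hs' : s < s')
    (hF : DifferentiableOn ℂ F (ellipseClosed s'))
    (hM : ∀ z ∈ ellipseBoundary s, ‖F z‖ ≤ M) :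
    ∃ b : ℤ → ℂ, (∀ n, ‖b n‖ ≤ M * Real.exp (-s) ^ n.natAbs) ∧
      ∀ θ : ℝ, HasSum (fun n : ℤ => b n * (Real.cos (n * θ) : ℂ)) (F (Real.cos θ : ℂ)) := by
  set G : ℂ → ℂ := fun w => F ((w + w⁻¹) / 2) with hGdef
  have hspos : 0 < s' := hs.trans hs'
  have hGd : DifferentiableOn ℂ G {w | Real.exp (-s') < ‖w‖ ∧ ‖w‖ < Real.exp s'} := by
    refine hF.comp ?_ fun w hw => joukowski_mem_ellipseClosed hspos hw.1.le hw.2.le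
    intro w hw
    have hw0 : w ≠ 0 := norm_pos_iff.mp ((Real.exp_pos _).trans hw.1)
    exact ((differentiableAt_id.add (differentiableAt_inv hw0)).div_const 2).differentiableWithinAt
  have hcoef := norm_laurent_coeff_le hs hs' hGd
    (fun w hw => hM _ (joukowski_mem_ellipseBoundary hs hw))
  have : Fact (0 < 2 * π) := ⟨Real.two_pi_pos⟩
  have hcont : Continuous fun t : AddCircle (2 * π) => G (AddCircle.toCircle t : ℂ) := by
    refine hGd.continuousOn.comp_continuous
      (continuous_subtype_val.comp AddCircle.continuous_toCircle) fun t => ?_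
    have h1 := Circle.norm_coe (AddCircle.toCircle t)
    exact ⟨(Real.exp_lt_one_iff.mpr (neg_lt_zero.mpr hspos)).trans_eq h1.symm,
      h1.trans_lt (Real.one_lt_exp_iff.mpr hspos)⟩
  set f : C(AddCircle (2 * π), ℂ) := ⟨_, hcont⟩ with hf
  have hfx : ∀ x : ℝ, f (x : AddCircle (2 * π)) = G (Complex.exp (x * Complex.I)) := by
    intro x
    simp [hf, AddCircle.toCircle_apply_mk, Circle.coe_exp]
  have hfour : ∀ (n : ℤ) (x : ℝ), fourier n (x : AddCircle (2 * π)) =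
      Complex.exp (x * Complex.I) ^ n := by
    intro n x
    rw [fourier_coe_apply, ← Complex.exp_int_mul]
    congr 1
    have : (π : ℂ) ≠ 0 := by exact_mod_cast Real.pi_ne_zero
    push_cast
    field_simp
  have hfc : ∀ n : ℤ, fourierCoeff f n =
      (2 * π * Complex.I : ℂ)⁻¹ • ∮ w in C(0, 1), w⁻¹ • (w ^ (-n) * G w) := by
    intro n
    rw [fourierCoeff_eq_intervalIntegral f n 0, circleIntegral, zero_add]
    simp_rw [hfx, hfour, deriv_circleMap, circleMap_zero]
    have : ∀ θ : ℝ, ((1 : ℝ) * Complex.exp (θ * Complex.I) * Complex.I) •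
        ((1 : ℝ) * Complex.exp (θ * Complex.I))⁻¹ •
          (((1 : ℝ) * Complex.exp (θ * Complex.I)) ^ (-n) *
            G ((1 : ℝ) * Complex.exp (θ * Complex.I))) =
        Complex.I * (Complex.exp (θ * Complex.I) ^ (-n) • G (Complex.exp (θ * Complex.I))) := by
      intro θ
      have := Complex.exp_ne_zero (θ * Complex.I)
      simp only [Complex.ofReal_one, one_mul, smul_eq_mul]
      field_simp
    simp_rw [this]
    rw [intervalIntegral.integral_const_mul, Complex.real_smul, smul_eq_mul, ← mul_assoc]
    congr 1
    have : (π : ℂ) ≠ 0 := by exact_mod_cast Real.pi_ne_zero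
    push_cast
    field_simp
  have hb : ∀ n : ℤ, ‖fourierCoeff f n‖ ≤ M * Real.exp (-s) ^ n.natAbs := by
    intro n; rw [hfc]; exact hcoef n
  have hr : Real.exp (-s) < 1 := Real.exp_lt_one_iff.mpr (by linarith)
  have hgeo : Summable fun n : ℤ => Real.exp (-s) ^ n.natAbs := by
    refine Summable.of_nat_of_neg ?_ ?_ <;>
    simpa using summable_geometric_of_lt_one (Real.exp_pos _).le hr
  have hsum : Summable (fourierCoeff f) := Summable.of_norm_bounded (hgeo.mul_left M) hb
  refine ⟨fourierCoeff f, hb, fun θ => ?_⟩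
  have hval : ∀ x : ℝ, G (Complex.exp (x * Complex.I)) = F (Real.cos x : ℂ) := by
    intro x
    simp only [hGdef]
    rw [← Complex.exp_neg, Complex.ofReal_cos, Complex.cos, neg_mul]
  have h1 := has_pointwise_sum_fourier_series_of_summable hsum (θ : AddCircle (2 * π))
  have h2 := has_pointwise_sum_fourier_series_of_summable hsum ((-θ : ℝ) : AddCircle (2 * π))
  simp_rw [hfx, hval, hfour] at h1 h2
  rw [Real.cos_neg] at h2
  have h3 := (h1.add h2).mul_left (1 / 2 : ℂ)
  have hav : (1 / 2 : ℂ) * (F (Real.cos θ : ℂ) + F (Real.cos θ : ℂ)) = F (Real.cos θ : ℂ) := by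
    ring
  rw [hav] at h3
  refine h3.congr_fun fun n => ?_
  rw [← Complex.exp_int_mul, ← Complex.exp_int_mul, Complex.ofReal_cos, Complex.cos]
  push_cast
  simp only [smul_eq_mul]
  ring_nf

theorem hasSum_geometric_tail {r : ℝ} (hr0 : 0 < r) (hr : r < 1) (K : ℕ) :
    HasSum (fun n : ℕ => if K ≤ n then r ^ n else 0) (r ^ K / (1 - r)) := by
  have h0 : ∑ i ∈ Finset.range K, (if K ≤ i then r ^ i else 0) = 0 :=
    Finset.sum_eq_zero fun i hi => if_neg (not_le.mpr (Finset.mem_range.mp hi))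
  have h : HasSum (fun n : ℕ => if K ≤ n + K then r ^ (n + K) else 0) (r ^ K / (1 - r)) := by
    have := (hasSum_geometric_of_lt_one hr0.le hr).mul_left (r ^ K)
    rw [← div_eq_mul_inv] at this
    refine this.congr_fun fun n => ?_
    rw [if_pos (Nat.le_add_left _ _), pow_add, mul_comm]
  simpa only [h0, add_zero] using
    (hasSum_nat_add_iff (f := fun n : ℕ => if K ≤ n then r ^ n else 0) K).mp h

theorem hasSum_int_geometric_tail {r : ℝ} (hr0 : 0 < r) (hr : r < 1) {K : ℕ} (hK : 0 < K) :
    HasSum (fun n : ℤ => if (K : ℤ) ≤ |n| then r ^ n.natAbs else 0)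
      (2 * (r ^ K / (1 - r))) := by
  have h := hasSum_geometric_tail hr0 hr K
  have h1 := (hasSum_nat_add_iff' 1).mpr h
  rw [Finset.sum_range_one, if_neg (by omega), sub_zero] at h1
  rw [two_mul]
  refine HasSum.of_nat_of_neg_add_one (h.congr_fun fun n => ?_) (h1.congr_fun fun n => ?_)
  · have : ((K : ℤ) ≤ |(n : ℤ)|) ↔ K ≤ n := by rw [Nat.abs_cast]; omega
    simp only [this, Int.natAbs_natCast]
  · have e : (-((n : ℤ) + 1)).natAbs = n + 1 := by omega
    have : ((K : ℤ) ≤ |(-((n : ℤ) + 1))|) ↔ K ≤ n + 1 := by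
      rw [Int.abs_eq_natAbs, e]; omega
    simp only [this, e]

theorem norm_le_of_hasSum_cos {u : ℝ → ℂ} {b : ℤ → ℂ} {M r : ℝ} (hr0 : 0 < r) (hr : r < 1)
    (hb : ∀ n, ‖b n‖ ≤ M * r ^ n.natAbs)
    (hu : ∀ θ : ℝ, HasSum (fun n : ℤ => b n * (Real.cos (n * θ) : ℂ)) (u θ))
    (hcont : Continuous u) {K : ℕ} (hK : 4 ≤ K) {θ₀ : ℝ} (hθ₀ : 0 < Real.sin θ₀) :
    ‖u θ₀‖ ≤ 20 * M * (r ^ K / (1 - r)) +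
      ((K : ℝ) + 1) ^ 2 / 2 * ∫ θ in (0 : ℝ)..π, ‖u θ‖ * Real.sin θ := by
  obtain ⟨Φ, hΦ, hΦb, hΦm⟩ := exists_cosine_reproducing_kernel K hK θ₀ hθ₀
  set C : ℝ := ((K : ℝ) + 1) ^ 2 / 2 with hC
  have hC0 : 0 ≤ C := by positivity
  set w : ℝ → ℝ := fun θ => Φ θ * Real.sin θ with hw
  have hwcont : Continuous w := by fun_prop
  have hwb : ∀ θ, |w θ| ≤ C := fun θ => by
    rw [hw, abs_mul]
    exact (mul_le_of_le_one_right (abs_nonneg _) (Real.abs_sin_le_one θ)).trans (hΦb θ)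
  have hgeo : Summable fun n : ℤ => r ^ n.natAbs := by
    refine Summable.of_nat_of_neg ?_ ?_ <;>
    simpa using summable_geometric_of_lt_one hr0.le hr
  have hint : HasSum (fun n : ℤ => b n * ((∫ θ in (0 : ℝ)..π, Real.cos (n * θ) * w θ : ℝ) : ℂ))
      (∫ θ in (0 : ℝ)..π, u θ * (w θ : ℂ)) := by
    have h := intervalIntegral.hasSum_integral_of_dominated_convergence (μ := volume)
      (a := (0 : ℝ)) (b := π)
      (F := fun (n : ℤ) (θ : ℝ) => b n * ((Real.cos (n * θ) * w θ : ℝ) : ℂ))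
      (f := fun θ => u θ * (w θ : ℂ))
      (fun n _ => M * r ^ n.natAbs * C)
      (fun n => (Continuous.aestronglyMeasurable (by fun_prop)))
      (fun n => Filter.Eventually.of_forall fun θ _ => by
        have h1 := Real.abs_cos_le_one (n * θ)
        have h2 := hwb θ
        rw [norm_mul, Complex.norm_real, Real.norm_eq_abs, abs_mul]
        have h3 : |Real.cos (n * θ)| * |w θ| ≤ C :=
          (mul_le_of_le_one_left (abs_nonneg _) h1).trans h2
        exact mul_le_mul (hb n) h3 (by positivity) ((norm_nonneg _).trans (hb n)))
      (Filter.Eventually.of_forall fun θ _ => (hgeo.mul_left M).mul_right C)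
      (intervalIntegrable_const)
      (Filter.Eventually.of_forall fun θ _ => by
        refine ((hu θ).mul_right (w θ : ℂ)).congr_fun fun n => ?_
        push_cast; ring)
    refine h.congr_fun fun n => ?_
    rw [intervalIntegral.integral_const_mul, intervalIntegral.integral_ofReal]
  have hdiff : ‖u θ₀ - ∫ θ in (0 : ℝ)..π, u θ * (w θ : ℂ)‖ ≤
      10 * M * (2 * (r ^ K / (1 - r))) := by
    have hsub := (hu θ₀).sub hint
    have htail := (hasSum_int_geometric_tail hr0 hr (by omega : 0 < K)).mul_left (10 * M)
    rw [← hsub.tsum_eq]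
    refine tsum_of_norm_bounded htail fun n => ?_
    rw [← mul_sub, ← Complex.ofReal_sub, norm_mul, Complex.norm_real, Real.norm_eq_abs]
    have hm := hΦm n
    calc _ ≤ M * r ^ n.natAbs * (if (K : ℤ) ≤ |n| then 10 else 0) :=
          mul_le_mul (hb n) hm (abs_nonneg _) ((norm_nonneg _).trans (hb n))
      _ = _ := by split_ifs <;> ring
  have hL : ‖∫ θ in (0 : ℝ)..π, u θ * (w θ : ℂ)‖ ≤
      C * ∫ θ in (0 : ℝ)..π, ‖u θ‖ * Real.sin θ := by
    rw [← intervalIntegral.integral_const_mul]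
    refine intervalIntegral.norm_integral_le_of_norm_le Real.pi_pos.le
      (Filter.Eventually.of_forall fun θ hθ => ?_)
      (Continuous.intervalIntegrable (by fun_prop) _ _)
    have hs : 0 ≤ Real.sin θ := Real.sin_nonneg_of_nonneg_of_le_pi hθ.1.le hθ.2
    rw [norm_mul, Complex.norm_real, Real.norm_eq_abs, hw, abs_mul, abs_of_nonneg hs]
    calc _ ≤ ‖u θ‖ * (C * Real.sin θ) := by gcongr; exact hΦb θ
      _ = _ := by ring
  have htri := norm_sub_norm_le (u θ₀) (∫ θ in (0 : ℝ)..π, u θ * (w θ : ℂ))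
  linarith

theorem ofReal_mem_ellipseClosed {x : ℝ} (hx : x ∈ Set.Icc (-1 : ℝ) 1) (t : ℝ) :
    (x : ℂ) ∈ ellipseClosed t := by
  have h1 := Real.one_le_cosh t
  simp only [ellipseClosed, Set.mem_ofPred_eq, Complex.ofReal_re, Complex.ofReal_im]
  rw [zero_pow two_ne_zero, zero_div, add_zero, div_le_one (by positivity)]
  have := abs_le.mpr hx
  rw [← sq_abs x]
  gcongr
  linarith

theorem integral_comp_cos_mul_sin {h : ℝ → ℝ} (hh : ContinuousOn h (Set.Icc (-1) 1)) :
    ∫ θ in (0 : ℝ)..π, h (Real.cos θ) * Real.sin θ = ∫ y in Set.Ioo (-1 : ℝ) 1, h y := by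
  have hsub := intervalIntegral.integral_comp_mul_deriv'' (a := 0) (b := π)
    (f := Real.cos) (f' := fun θ => -Real.sin θ) (g := h)
    Real.continuous_cos.continuousOn
    (fun θ _ => (Real.hasDerivAt_cos θ).hasDerivWithinAt)
    Real.continuous_sin.neg.continuousOn
    (hh.mono (by rintro _ ⟨θ, -, rfl⟩; exact Real.cos_mem_Icc θ))
  rw [Real.cos_zero, Real.cos_pi, intervalIntegral.integral_symm (-1) 1,
    intervalIntegral.integral_of_le (by norm_num : (-1 : ℝ) ≤ 1),
    integral_Ioc_eq_integral_Ioo] at hsub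
  simp only [Function.comp_apply, mul_neg, intervalIntegral.integral_neg, neg_inj] at hsub
  exact hsub

/-- Interpolation between the `L¹` norm on `(-1, 1)` and the sup norm on a confocal ellipse. -/
theorem norm_le_ellipse_add_integral {F : ℂ → ℂ} {s s' M : ℝ} (hs : 0 < s) (hs' : s < s')
    (hF : DifferentiableOn ℂ F (ellipseClosed s'))
    (hM : ∀ z ∈ ellipseBoundary s, ‖F z‖ ≤ M) {K : ℕ} (hK : 4 ≤ K)
    {x : ℝ} (hx : x ∈ Set.Ioo (-1 : ℝ) 1) :
    ‖F x‖ ≤ 20 * M * (Real.exp (-s) ^ K / (1 - Real.exp (-s))) +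
      ((K : ℝ) + 1) ^ 2 / 2 * ∫ y in Set.Ioo (-1 : ℝ) 1, ‖F y‖ := by
  obtain ⟨b, hb, hu⟩ := exists_cosine_series hs hs' hF hM
  have hFc : ContinuousOn (fun y : ℝ => F y) (Set.Icc (-1) 1) :=
    hF.continuousOn.comp Complex.continuous_ofReal.continuousOn
      fun y hy => ofReal_mem_ellipseClosed hy s'
  have hcont : Continuous fun θ : ℝ => F (Real.cos θ : ℂ) :=
    hFc.comp_continuous Real.continuous_cos Real.cos_mem_Icc
  have hsin : 0 < Real.sin (Real.arccos x) := by
    rw [Real.sin_arccos]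
    exact Real.sqrt_pos.mpr (by nlinarith [hx.1, hx.2])
  have h := norm_le_of_hasSum_cos (Real.exp_pos _) (Real.exp_lt_one_iff.mpr (neg_lt_zero.mpr hs))
    hb hu hcont hK hsin
  rwa [integral_comp_cos_mul_sin (h := fun y => ‖F y‖) hFc.norm,
    Real.cos_arccos hx.1.le hx.2.le] at h

theorem exists_gt_of_lt_Blam {lam : ℝ → EReal} {s : ℝ} (hs : (s : EReal) < Blam lam) :
    ∃ r : ℝ, 0 ≤ r ∧ lam r ≠ ⊤ ∧ s < r := by
  obtain ⟨_, ⟨r, hr, hlr, rfl⟩, hsr⟩ := lt_sSup_iff.mp hs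
  exact ⟨r, hr, hlr, EReal.coe_lt_coe_iff.mp hsr⟩

theorem lt_Blam_of_lt {lam : ℝ → EReal} {s r : ℝ} (hr : 0 ≤ r) (hlr : lam r ≠ ⊤) (hsr : s < r) :
    (s : EReal) < Blam lam :=
  (EReal.coe_lt_coe_iff.mpr hsr).trans_le (le_sSup ⟨r, hr, hlr, rfl⟩)

theorem toReal_mono_of_ne_top {lam : ℝ → EReal} (hlam_bot : ∀ r, lam r ≠ ⊥)
    (hlam_mono : MonotoneOn lam (Set.Ici 0)) {s r : ℝ} (hs : 0 ≤ s) (hsr : s ≤ r)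
    (hlr : lam r ≠ ⊤) : (lam s).toReal ≤ (lam r).toReal :=
  EReal.toReal_le_toReal (hlam_mono hs (hs.trans hsr) hsr) (hlam_bot s) hlr

/-- A bound by `exp (λ(s) - k s)` for all `s` in the interior of the domain of `λ` improves to a
bound by the infimum `exp (-λ*(k))`. -/
theorem le_mul_expNegLamStar {lam : ℝ → EReal} (hlam_bot : ∀ r, lam r ≠ ⊥)
    (hlam_mono : MonotoneOn lam (Set.Ici 0)) {t A D k : ℝ} (ht : 0 < t)
    (htB : (t : EReal) < Blam lam) (hA : 0 ≤ A) (hk : 0 ≤ k)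
    (hD : ∀ s : ℝ, t ≤ s → (s : EReal) < Blam lam →
      D ≤ A * Real.exp ((lam s).toReal - k * s)) :
    D ≤ Real.exp ((lam t).toReal - (lam 0).toReal) * A * expNegLamStar lam k := by
  obtain ⟨R, hR, hlR, htR⟩ := exists_gt_of_lt_Blam htB
  have hlt : lam t ≠ ⊤ :=
    ((hlam_mono ht.le hR htR.le).trans_lt (lt_top_iff_ne_top.mpr hlR)).ne
  set E := Real.exp ((lam t).toReal - (lam 0).toReal) with hE
  have hE1 : 1 ≤ E := Real.one_le_exp
    (sub_nonneg.mpr (toReal_mono_of_ne_top hlam_bot hlam_mono le_rfl ht.le hlt))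
  have key : ∀ r : ℝ, 0 ≤ r → lam r ≠ ⊤ → D ≤ E * A * Real.exp ((lam r).toReal - k * r) := by
    intro r hr hlr
    rcases le_or_gt r t with hrt | hrt
    · refine (hD t le_rfl htB).trans ?_
      have h0 := toReal_mono_of_ne_top hlam_bot hlam_mono le_rfl hr hlr
      have hkr : k * r ≤ k * t := by gcongr
      rw [mul_comm E A, mul_assoc, hE, ← Real.exp_add]
      gcongr
      linarith
    · have hlim : D ≤ A * Real.exp ((lam r).toReal - k * r) := by
        have hc : Filter.Tendsto (fun s : ℝ => A * Real.exp ((lam r).toReal - k * s))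
            (nhdsWithin r (Set.Iio r)) (nhds (A * Real.exp ((lam r).toReal - k * r))) :=
          ((by fun_prop : Continuous fun s : ℝ =>
            A * Real.exp ((lam r).toReal - k * s)).tendsto r).mono_left nhdsWithin_le_nhds
        refine ge_of_tendsto hc ?_
        filter_upwards [Ioo_mem_nhdsLT hrt] with s hs
        refine (hD s hs.1.le (lt_Blam_of_lt hr hlr hs.2)).trans ?_
        have := toReal_mono_of_ne_top hlam_bot hlam_mono (ht.le.trans hs.1.le) hs.2.le hlr
        gcongr
      refine hlim.trans ?_
      rw [mul_assoc]
      exact le_mul_of_one_le_left (by positivity) hE1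
  rcases hA.eq_or_lt with rfl | hApos
  · simpa using key t ht.le hlt
  · rw [mul_comm, ← div_le_iff₀ (by positivity)]
    refine le_csInf ⟨_, t, ht.le, hlt, rfl⟩ ?_
    rintro _ ⟨r, hr, hlr, rfl⟩
    rw [div_le_iff₀ (by positivity), mul_comm]
    exact key r hr hlr


/-- `L^∞`-`L¹` interpolation inequality on `(-1,1)` for functions in
`A^λ(-1,1)` (Theorem 3.4, part 4): there are `δ₀ > 0` and `c > 0` such that
`‖g‖_{L^∞(-1,1)} ≤ c exp(-λ*(⌊√(2/δ)⌋ - 1)) ‖g‖_{A^λ(-1,1)} + (1/δ) ‖g‖_{L¹(-1,1)}`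
for all `0 < δ ≤ δ₀`. -/
theorem interpolation_inequality_interval
    (lam : ℝ → EReal) (hlam_bot : ∀ r, lam r ≠ ⊥)
    (hlam_mono : MonotoneOn lam (Set.Ici 0))
    (hBpos : 0 < Blam lam) :
    ∃ (δ₀ c : ℝ), 0 < δ₀ ∧ 0 < c ∧
      ∀ (g : ℝ → ℝ), AnalyticOnNhd ℝ g (Set.Ioo (-1 : ℝ) 1) →
      ∀ (gext : ℂ → ℂ), DifferentiableOn ℂ gext (ellipseRegion lam) →
        (∀ x ∈ Set.Ioo (-1 : ℝ) 1, gext x = g x) →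
      ∀ (Ng : ℝ),
        (∀ t : ℝ, 0 < t → ((t : ℝ) : EReal) < Blam lam →
          ∀ z ∈ ellipseBoundary t, Real.exp (-(lam t).toReal) * ‖gext z‖ ≤ Ng) →
      ∀ (δ : ℝ), 0 < δ → δ ≤ δ₀ →
      ∀ x ∈ Set.Ioo (-1 : ℝ) 1,
        |g x| ≤ c * expNegLamStar lam (((⌊Real.sqrt (2 / δ)⌋ : ℤ) : ℝ) - 1) * Ng
            + (1 / δ) * ∫ y in Set.Ioo (-1 : ℝ) 1, |g y| := by
  obtain ⟨t, ht, htB⟩ : ∃ t : ℝ, 0 < t ∧ (t : EReal) < Blam lam := by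
    obtain ⟨R, -, hlR, hR0⟩ := exists_gt_of_lt_Blam (lam := lam) (s := 0) (by exact_mod_cast hBpos)
    exact ⟨R / 2, by positivity, lt_Blam_of_lt hR0.le hlR (by linarith)⟩
  have hgap : 0 < 1 - Real.exp (-t) := sub_pos.mpr (Real.exp_lt_one_iff.mpr (neg_lt_zero.mpr ht))
  refine ⟨2 / 25, Real.exp ((lam t).toReal - (lam 0).toReal) * (20 / (1 - Real.exp (-t))),
    by norm_num, by positivity, ?_⟩
  intro g _ gext hd hext Ng hNg δ hδ hδ₀ x hx
  have hNg0 : 0 ≤ Ng := by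
    have hmem := joukowski_mem_ellipseBoundary (w := (Real.exp t : ℂ)) ht
      (Or.inl (by rw [Complex.norm_real, Real.norm_eq_abs, abs_of_pos (Real.exp_pos t)]))
    exact (by positivity : (0 : ℝ) ≤ _).trans (hNg t ht htB _ hmem)
  obtain ⟨K, hK, hKfloor, hKδ⟩ : ∃ K : ℕ, 4 ≤ K ∧
      ((⌊Real.sqrt (2 / δ)⌋ : ℤ) : ℝ) - 1 = K ∧ ((K : ℝ) + 1) ^ 2 / 2 ≤ 1 / δ := by
    have h5 : (5 : ℝ) ≤ Real.sqrt (2 / δ) := by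
      refine Real.le_sqrt_of_sq_le ?_
      rw [le_div_iff₀ hδ]
      linarith
    have h5' : (5 : ℤ) ≤ ⌊Real.sqrt (2 / δ)⌋ := Int.le_floor.mpr (by exact_mod_cast h5)
    obtain ⟨K, hKeq⟩ : ∃ K : ℕ, ⌊Real.sqrt (2 / δ)⌋ = K + 1 :=
      ⟨(⌊Real.sqrt (2 / δ)⌋ - 1).toNat, by omega⟩
    refine ⟨K, by omega, by rw [hKeq]; push_cast; ring, ?_⟩
    have hle := Int.floor_le (Real.sqrt (2 / δ))
    rw [hKeq] at hle
    push_cast at hle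
    have hsq : ((K : ℝ) + 1) ^ 2 ≤ 2 / δ := by
      rw [← Real.sq_sqrt (by positivity : 0 ≤ 2 / δ)]
      gcongr
    calc ((K : ℝ) + 1) ^ 2 / 2 ≤ 2 / δ / 2 := by gcongr
      _ = 1 / δ := by ring
  have hL : ∫ y in Set.Ioo (-1 : ℝ) 1, ‖gext y‖ = ∫ y in Set.Ioo (-1 : ℝ) 1, |g y| :=
    setIntegral_congr_fun measurableSet_Ioo fun y hy => by
      simp only [hext y hy, Complex.norm_real, Real.norm_eq_abs]
  have hL0 : 0 ≤ ∫ y in Set.Ioo (-1 : ℝ) 1, |g y| := integral_nonneg fun y => abs_nonneg _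
  rw [hKfloor]
  have hmain := le_mul_expNegLamStar hlam_bot hlam_mono (k := K)
    (A := 20 / (1 - Real.exp (-t)) * Ng)
    (D := |g x| - (1 / δ) * ∫ y in Set.Ioo (-1 : ℝ) 1, |g y|) ht htB (by positivity)
    (Nat.cast_nonneg K) ?_
  · linarith
  · intro s hts hsB
    have hs : 0 < s := ht.trans_le hts
    obtain ⟨R, hR, hlR, hsR⟩ := exists_gt_of_lt_Blam hsB
    obtain ⟨s', hss', hltR⟩ := exists_between hsR
    have hdiff : DifferentiableOn ℂ gext (ellipseClosed s') :=
      hd.mono fun z hz => ⟨s', hs.trans hss', lt_Blam_of_lt hR hlR hltR, hz⟩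
    have hM : ∀ z ∈ ellipseBoundary s, ‖gext z‖ ≤ Real.exp (lam s).toReal * Ng := by
      intro z hz
      have h := hNg s hs hsB z hz
      rwa [Real.exp_neg, inv_mul_le_iff₀ (Real.exp_pos _)] at h
    have h := norm_le_ellipse_add_integral hs hss' hdiff hM hK hx
    rw [hext x hx, Complex.norm_real, Real.norm_eq_abs, hL] at h
    have h2 := mul_le_mul_of_nonneg_right hKδ hL0
    have h3 : 20 * (Real.exp (lam s).toReal * Ng) * (Real.exp (-s) ^ K / (1 - Real.exp (-s))) ≤
        20 / (1 - Real.exp (-t)) * Ng * Real.exp ((lam s).toReal - K * s) := by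
      have hgaps : 1 - Real.exp (-t) ≤ 1 - Real.exp (-s) := by
        have := Real.exp_le_exp.mpr (neg_le_neg hts)
        linarith
      calc _ = 20 * (Real.exp (lam s).toReal * Ng) * (Real.exp (-s) ^ K) /
            (1 - Real.exp (-s)) := by ring
        _ ≤ 20 * (Real.exp (lam s).toReal * Ng) * (Real.exp (-s) ^ K) /
            (1 - Real.exp (-t)) := by gcongr
        _ = _ := by
          rw [← Real.exp_nat_mul, sub_eq_add_neg (lam s).toReal, Real.exp_add, mul_neg]
          ring
    linarith
end

section
/- Fix t̄ > 0 and let f ∈ L²(−π,π) with Fourier coefficients f̂(n) := (1/2π)∫_{−π}^{π} f(x)e^{−inx} dx. Define u(z) := Σ_{n∈ℤ} exp(−n²·t̄)·f̂(n)·e^{inz} for z ∈ ℂ. Then for every r ≥ 0 and every z ∈ ℂ with |Im z| = r: |u(z)| ≤ 2·max{1, t̄^{−1/2}}·exp(r²/(4t̄))·‖f‖_{L²(−π,π)}. In particular, the periodic heat operator at time t̄ maps L²(−π,π) into A^λ(ℝ/2πℤ) with λ(r) = r²/(4t̄) and operator norm at most 2·max{1, t̄^{−1/2}}. -/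
open scoped Real ENNReal
open MeasureTheory

/-- The `n`-th Fourier coefficient `f̂(n) = (1/2π) ∫_{-π}^{π} f(x) e^{-inx} dx`. -/
noncomputable def fourierCoef (f : ℝ → ℂ) (n : ℤ) : ℂ :=
  (1 / (2 * π)) * ∫ x in (-π : ℝ)..π, f x * Complex.exp (-(Complex.I * n * x))

/-- The Gaussian sum over `ℕ` is dominated by the first term plus the half-line integral. -/
theorem sum_exp_neg_mul_sq_le (t : ℝ) (ht : 0 < t) (N : ℕ) :
    ∑ k ∈ Finset.range N, Real.exp (-t * (k : ℝ) ^ 2) ≤ 1 + √(π / t) / 2 := by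
  have hanti : AntitoneOn (fun x : ℝ => Real.exp (-t * x ^ 2)) (Set.Ici 0) := by
    intro x hx y hy hxy
    have hx' : (0 : ℝ) ≤ x := hx
    have : x ^ 2 ≤ y ^ 2 := by gcongr
    exact Real.exp_le_exp.2 (by nlinarith)
  have h1 : ∑ k ∈ Finset.range N, Real.exp (-t * ((k + 1 : ℕ) : ℝ) ^ 2) ≤ √(π / t) / 2 := by
    have h := AntitoneOn.sum_le_integral (x₀ := 0) (a := N)
      (hanti.mono (by intro x hx; exact hx.1))
    simp only [zero_add] at h
    refine h.trans ?_
    rw [intervalIntegral.integral_of_le (by positivity), ← integral_gaussian_Ioi t]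
    exact setIntegral_mono_set (integrable_exp_neg_mul_sq ht).integrableOn
      (Filter.Eventually.of_forall fun x => (Real.exp_pos _).le)
      (Filter.Eventually.of_forall fun x hx => hx.1)
  calc ∑ k ∈ Finset.range N, Real.exp (-t * (k : ℝ) ^ 2)
      ≤ ∑ k ∈ Finset.range (N + 1), Real.exp (-t * (k : ℝ) ^ 2) :=
        Finset.sum_le_sum_of_subset_of_nonneg (Finset.range_mono (Nat.le_succ N))
          fun _ _ _ => (Real.exp_pos _).le
    _ ≤ 1 + √(π / t) / 2 := by
        rw [Finset.sum_range_succ']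
        simp only [Nat.cast_zero, ne_eq, OfNat.ofNat_ne_zero, not_false_eq_true, zero_pow,
          mul_zero, Real.exp_zero]
        linarith

theorem summable_nat_exp_neg_mul_sq (t : ℝ) (ht : 0 < t) :
    Summable fun k : ℕ => Real.exp (-t * (k : ℝ) ^ 2) :=
  summable_of_sum_range_le (fun _ => (Real.exp_pos _).le) (sum_exp_neg_mul_sq_le t ht)

/-- A shifted Gaussian sum over `ℤ` is at most `2` plus the Gaussian integral. -/
theorem summable_and_tsum_int_exp_neg_mul_sub_sq_le (t : ℝ) (ht : 0 < t) (a : ℝ) :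
    Summable (fun n : ℤ => Real.exp (-t * ((n : ℝ) - a) ^ 2)) ∧
      ∑' n : ℤ, Real.exp (-t * ((n : ℝ) - a) ^ 2) ≤ 2 + √(π / t) := by
  set g : ℤ → ℝ := fun n => Real.exp (-t * ((n : ℝ) - a) ^ 2) with hg
  set e : ℤ ≃ ℤ := Equiv.addRight (⌊a⌋ + 1) with he
  have hs := summable_nat_exp_neg_mul_sq t ht
  have hfl := Int.floor_le a
  have hlt := Int.lt_floor_add_one a
  have hpos (k : ℕ) : g (e k) ≤ Real.exp (-t * (k : ℝ) ^ 2) := by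
    simp only [hg, he, Equiv.coe_addRight]
    push_cast
    have hk : (0 : ℝ) ≤ k := k.cast_nonneg
    have : (k : ℝ) ^ 2 ≤ (k + (⌊a⌋ + 1) - a) ^ 2 := by
      apply pow_le_pow_left₀ hk
      linarith
    exact Real.exp_le_exp.2 (by nlinarith)
  have hneg (k : ℕ) : g (e (-(k + 1 : ℤ))) ≤ Real.exp (-t * (k : ℝ) ^ 2) := by
    simp only [hg, he, Equiv.coe_addRight]
    push_cast
    have hk : (0 : ℝ) ≤ k := k.cast_nonneg
    have : (k : ℝ) ^ 2 ≤ (-(k + 1) + (⌊a⌋ + 1) - a) ^ 2 := by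
      rw [← neg_sq (-((k : ℝ) + 1) + (⌊a⌋ + 1) - a)]
      apply pow_le_pow_left₀ hk
      linarith
    exact Real.exp_le_exp.2 (by nlinarith)
  have hs1 : Summable fun k : ℕ => g (e k) :=
    Summable.of_nonneg_of_le (fun _ => (Real.exp_pos _).le) hpos hs
  have hs2 : Summable fun k : ℕ => g (e (-(k + 1 : ℤ))) :=
    Summable.of_nonneg_of_le (fun _ => (Real.exp_pos _).le) hneg hs
  have hsum : Summable fun n : ℤ => g (e n) := Summable.of_nat_of_neg_add_one hs1 hs2
  refine ⟨e.summable_iff.1 hsum, ?_⟩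
  have hle : ∑' k : ℕ, Real.exp (-t * (k : ℝ) ^ 2) ≤ 1 + √(π / t) / 2 :=
    Real.tsum_le_of_sum_range_le (fun _ => (Real.exp_pos _).le) (sum_exp_neg_mul_sq_le t ht)
  rw [← e.tsum_eq g, tsum_of_nat_of_neg_add_one (f := fun n => g (e n)) hs1 hs2]
  have h1 := hs1.tsum_le_tsum hpos hs
  have h2 := hs2.tsum_le_tsum hneg hs
  linarith

/-- Completing the square in the exponent of the heat multiplier. -/
theorem exp_neg_sq_mul_mul_exp_neg_mul (t : ℝ) (ht : 0 < t) (y x : ℝ) :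
    Real.exp (-(x ^ 2 * t)) * Real.exp (-(x * y)) =
      Real.exp (y ^ 2 / (4 * t)) * Real.exp (-t * (x - -y / (2 * t)) ^ 2) := by
  rw [← Real.exp_add, ← Real.exp_add]
  congr 1
  field_simp
  ring

theorem summable_exp_neg_sq_mul_mul_exp_neg_mul (t : ℝ) (ht : 0 < t) (y : ℝ) :
    Summable fun n : ℤ => Real.exp (-((n : ℝ) ^ 2 * t)) * Real.exp (-(n * y)) := by
  simp only [exp_neg_sq_mul_mul_exp_neg_mul t ht]
  exact (summable_and_tsum_int_exp_neg_mul_sub_sq_le t ht _).1.mul_left _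

theorem tsum_exp_neg_sq_mul_mul_exp_neg_mul_le (t : ℝ) (ht : 0 < t) (y : ℝ) :
    ∑' n : ℤ, Real.exp (-((n : ℝ) ^ 2 * t)) * Real.exp (-(n * y)) ≤
      Real.exp (y ^ 2 / (4 * t)) * (2 + √(π / t)) := by
  simp only [exp_neg_sq_mul_mul_exp_neg_mul t ht]
  rw [tsum_mul_left]
  gcongr
  exact (summable_and_tsum_int_exp_neg_mul_sub_sq_le t ht _).2

/-- Fourier coefficients are bounded by the `L²` norm. -/
theorem norm_fourierCoef_le (f : ℝ → ℂ)
    (hf : MemLp f 2 (volume.restrict (Set.Ioo (-π) π))) (n : ℤ) :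
    ‖fourierCoef f n‖ ≤
      (√(2 * π))⁻¹ * (eLpNorm f 2 (volume.restrict (Set.Ioo (-π) π))).toReal := by
  set μ := volume.restrict (Set.Ioo (-π) π) with hμ
  have hvol : μ Set.univ = ENNReal.ofReal (2 * π) := by
    rw [hμ, Measure.restrict_apply_univ, Real.volume_Ioo]
    congr 1
    ring
  have : IsFiniteMeasure μ := ⟨by rw [hvol]; exact ENNReal.ofReal_lt_top⟩
  have hint : ‖∫ x in (-π : ℝ)..π, f x * Complex.exp (-(Complex.I * n * x))‖ ≤
      (eLpNorm f 1 μ).toReal := by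
    rw [intervalIntegral.integral_of_le (by linarith [Real.pi_pos]),
      integral_Ioc_eq_integral_Ioo, ← hμ,
      eLpNorm_one_eq_lintegral_enorm,
      ← integral_norm_eq_lintegral_enorm hf.aestronglyMeasurable]
    refine (norm_integral_le_integral_norm _).trans (le_of_eq ?_)
    congr 1
    ext x
    rw [norm_mul, Complex.norm_exp]
    simp
  have hL : (eLpNorm f 1 μ).toReal ≤ (eLpNorm f 2 μ).toReal * √(2 * π) := by
    have h := eLpNorm_le_eLpNorm_mul_rpow_measure_univ (p := 1) (q := 2) (by norm_num)
      hf.aestronglyMeasurable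
    rw [hvol] at h
    have h' := ENNReal.toReal_mono (ENNReal.mul_ne_top hf.eLpNorm_ne_top
      (ENNReal.rpow_ne_top_of_nonneg (by norm_num) ENNReal.ofReal_ne_top)) h
    rw [ENNReal.toReal_mul, ← ENNReal.toReal_rpow,
      ENNReal.toReal_ofReal (by positivity)] at h'
    rw [Real.sqrt_eq_rpow]
    convert h' using 3
    norm_num
  have hc : ‖(1 / (2 * π) : ℂ)‖ = (2 * π)⁻¹ := by
    rw [norm_div, norm_mul, Complex.norm_real, Real.norm_of_nonneg Real.pi_pos.le]
    simp
  rw [fourierCoef, norm_mul, hc]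
  calc (2 * π)⁻¹ * ‖∫ x in (-π : ℝ)..π, f x * Complex.exp (-(Complex.I * n * x))‖
      ≤ (2 * π)⁻¹ * ((eLpNorm f 2 μ).toReal * √(2 * π)) := by
        gcongr
        exact hint.trans hL
    _ = (√(2 * π))⁻¹ * (eLpNorm f 2 μ).toReal := by
        have h0 : 0 < √(2 * π) := by positivity
        have hsq : √(2 * π) * √(2 * π) = 2 * π := Real.mul_self_sqrt (by positivity)
        generalize √(2 * π) = s at h0 hsq ⊢
        rw [← hsq]
        field_simp

theorem inv_sqrt_two_pi_mul_le (t : ℝ) (ht : 0 < t) :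
    (√(2 * π))⁻¹ * (2 + √(π / t)) ≤ 2 * max 1 (t ^ (-(1 : ℝ) / 2)) := by
  have hs : √(π / t) = √π * t ^ (-(1 : ℝ) / 2) := by
    rw [Real.sqrt_div Real.pi_pos.le, neg_div, Real.rpow_neg ht.le, ← Real.sqrt_eq_rpow,
      div_eq_mul_inv]
  rw [hs]
  set M := max 1 (t ^ (-(1 : ℝ) / 2))
  have h1 : 1 ≤ M := le_max_left _ _
  have h2 : t ^ (-(1 : ℝ) / 2) ≤ M := le_max_right _ _
  have hp : √π ≤ √(2 * π) := Real.sqrt_le_sqrt (by linarith [Real.pi_pos])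
  have h3 : 2 ≤ √(2 * π) := Real.le_sqrt_of_sq_le (by linarith [Real.pi_gt_three])
  have h0 : 0 < √(2 * π) := by positivity
  rw [inv_mul_le_iff₀ h0]
  have h4 : √π * t ^ (-(1 : ℝ) / 2) ≤ √(2 * π) * M := by gcongr
  nlinarith

theorem norm_heat_term_le (t : ℝ) {c : ℂ} {C : ℝ} (hc : ‖c‖ ≤ C) (n : ℤ) (z : ℂ) :
    ‖(Real.exp (-((n : ℝ) ^ 2 * t)) : ℂ) * c * Complex.exp (Complex.I * n * z)‖ ≤
      C * (Real.exp (-((n : ℝ) ^ 2 * t)) * Real.exp (-(n * z.im))) := by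
  have he : ‖Complex.exp (Complex.I * n * z)‖ = Real.exp (-(n * z.im)) := by
    rw [Complex.norm_exp]
    simp
  rw [norm_mul, norm_mul, he, Complex.norm_real, Real.norm_of_nonneg (Real.exp_pos _).le,
    mul_comm _ ‖c‖, mul_assoc]
  gcongr

/-- The periodic heat semigroup is smoothing into the space
`A^λ(ℝ/2πℤ)` with `λ(r) = r²/(4t̄)` (Lemma 4.1, part 1): the analytic extension
`u(z) = Σ_n exp(-n² t̄) f̂(n) e^{inz}` of the solution at time `t̄` is entire and satisfies
`|u(z)| ≤ 2 max{1, t̄^{-1/2}} exp(r²/(4t̄)) ‖f‖_{L²(-π,π)}` whenever `|Im z| = r ≥ 0`. -/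
theorem heat_semigroup_analytic_bound (tb : ℝ) (htb : 0 < tb)
    (f : ℝ → ℂ) (hf : MemLp f 2 (volume.restrict (Set.Ioo (-π) π)))
    (u : ℂ → ℂ)
    (hu : ∀ z : ℂ, u z =
      ∑' n : ℤ, (Real.exp (-((n : ℝ) ^ 2 * tb)) : ℂ) * fourierCoef f n *
        Complex.exp (Complex.I * n * z)) :
    Differentiable ℂ u ∧
    ∀ r : ℝ, 0 ≤ r → ∀ z : ℂ, |z.im| = r →
      ‖u z‖
        ≤ 2 * max 1 (tb ^ (-(1 : ℝ) / 2)) * Real.exp (r ^ 2 / (4 * tb)) *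
            (eLpNorm f 2 (volume.restrict (Set.Ioo (-π) π))).toReal := by
  set C := (√(2 * π))⁻¹ * (eLpNorm f 2 (volume.restrict (Set.Ioo (-π) π))).toReal with hC
  have hcoef : ∀ n, ‖fourierCoef f n‖ ≤ C := norm_fourierCoef_le f hf
  have hC0 : 0 ≤ C := (norm_nonneg _).trans (hcoef 0)
  constructor
  · rw [funext hu]
    intro z
    set R := |z.im| + 1 with hR
    have hopen : IsOpen {w : ℂ | |w.im| < R} :=
      isOpen_lt (by fun_prop) continuous_const
    have hsum : Summable fun n : ℤ =>
        C * (Real.exp (-((n : ℝ) ^ 2 * tb)) * Real.exp (-(n * R)) +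
          Real.exp (-((n : ℝ) ^ 2 * tb)) * Real.exp (-(n * -R))) :=
      ((summable_exp_neg_sq_mul_mul_exp_neg_mul tb htb R).add
        (summable_exp_neg_sq_mul_mul_exp_neg_mul tb htb (-R))).mul_left C
    refine (Complex.differentiableOn_tsum_of_summable_norm hsum (fun n => ?_) hopen
      (fun n w hw => ?_)).differentiableAt (hopen.mem_nhds ?_)
    · fun_prop
    · refine (norm_heat_term_le tb (hcoef n) n w).trans ?_
      rw [← mul_add]
      gcongr
      have hw' := abs_lt.1 (show |w.im| < R from hw)
      rcases le_total 0 (n : ℝ) with hn | hn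
      · exact (Real.exp_le_exp.2 (by nlinarith)).trans
          (le_add_of_nonneg_left (Real.exp_pos _).le)
      · exact (Real.exp_le_exp.2 (by nlinarith)).trans
          (le_add_of_nonneg_right (Real.exp_pos _).le)
    · exact lt_add_one |z.im|
  · intro r _ z hz
    have hr : r ^ 2 = z.im ^ 2 := by rw [← hz, sq_abs]
    rw [hu z, hr]
    calc _ ≤ ∑' n : ℤ, C * (Real.exp (-((n : ℝ) ^ 2 * tb)) * Real.exp (-(n * z.im))) :=
          tsum_of_norm_bounded
            ((summable_exp_neg_sq_mul_mul_exp_neg_mul tb htb z.im).mul_left C).hasSum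
            fun n => norm_heat_term_le tb (hcoef n) n z
      _ ≤ C * (Real.exp (z.im ^ 2 / (4 * tb)) * (2 + √(π / tb))) := by
          rw [tsum_mul_left]
          gcongr
          exact tsum_exp_neg_sq_mul_mul_exp_neg_mul_le tb htb z.im
      _ = ((√(2 * π))⁻¹ * (2 + √(π / tb))) * Real.exp (z.im ^ 2 / (4 * tb)) *
            (eLpNorm f 2 (volume.restrict (Set.Ioo (-π) π))).toReal := by
          rw [hC]
          ring
      _ ≤ _ := by
          gcongr ?_ * _ * _
          exact inv_sqrt_two_pi_mul_le tb htb
end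

section
/- Fix t̄ > 0 and p > 0. Let T be the periodic heat operator at time t̄, let f† ∈ H^p(−π,π) with exact data g† := Tf†, and suppose the noise model holds with parameters ε, η. Let f̂_α be a minimizer of f ↦ (1/α)‖Tf − g^obs‖_{L¹(−π,π)} + ‖f‖²_{L²(−π,π)}. Set γ(δ) := (8·max{1, t̄^{−1/2}}/(exp(3t̄) − 1))·exp(−⌊π/δ − 1/2⌋²·t̄), and suppose the parameter choice α = α(ε,η) satisfies √(2ε/α) + 2ηγ(2η)/α ≤ C_e for a fixed constant C_e. Then there exist η₀ > 0, ε₀ > 0, α₀ > 0 and a constant C > 0 (depending only on t̄, p, f† and C_e) such that for all 0 < η ≤ η₀, 0 ≤ ε ≤ ε₀ and 0 < α ≤ α₀: ‖f̂_α − f†‖²_{L²(−π,π)} ≤ C·(ε/α + (η²/α²)·exp(−π²t̄/(8η²)) + (−ln α)^{−p}) and ‖Tf̂_α − g†‖_{L¹(−π,π)} ≤ C·(ε + (η²/α)·exp(−π²t̄/(8η²)) + α·(−ln α)^{−p}). -/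
open scoped Real ENNReal
open MeasureTheory

/-- The periodic heat operator at time `t̄`: `(T f)(x) = Σ_n exp(-n² t̄) f̂(n) e^{inx}`. -/
noncomputable def heatOp (tb : ℝ) (f : ℝ → ℂ) (x : ℝ) : ℂ :=
  ∑' n : ℤ, (Real.exp (-((n : ℝ) ^ 2 * tb)) : ℂ) * fourierCoef f n *
    Complex.exp (Complex.I * n * x)

/-- Lebesgue measure on the period interval `(-π, π)`. -/
local notation "μ₀" => Measure.restrict (volume : Measure ℝ) (Set.Ioo (-π) π)

theorem fourierCoef_eq_fourierCoeffOn (f : ℝ → ℂ) (n : ℤ) :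
    fourierCoef f n = fourierCoeffOn (neg_lt_self Real.pi_pos) f n := by
  rw [fourierCoef, fourierCoeffOn_eq_integral, Complex.real_smul]
  have h : ∀ x : ℝ, Complex.exp (-(Complex.I * n * x)) =
      fourier (-n) (x : AddCircle (π - -π)) := fun x => by
    rw [fourier_coe_apply]
    congr 1
    push_cast
    field_simp
    ring
  simp_rw [h, smul_eq_mul, mul_comm (f _)]
  push_cast
  ring_nf

theorem integral_norm_eq_toReal_eLpNorm_one {X : Type*} [MeasurableSpace X] {μ : Measure X}
    {g : X → ℂ} (hg : AEStronglyMeasurable g μ) :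
    ∫ x, ‖g x‖ ∂μ = (eLpNorm g 1 μ).toReal := by
  rw [eLpNorm_one_eq_lintegral_enorm, integral_norm_eq_lintegral_enorm hg]

theorem integral_norm_sq_eq_toReal_eLpNorm_two {X : Type*} [MeasurableSpace X] {μ : Measure X}
    {f : X → ℂ} (hf : MemLp f 2 μ) :
    ∫ x, ‖f x‖ ^ 2 ∂μ = (eLpNorm f 2 μ).toReal ^ 2 := by
  have h0 : 0 ≤ ∫ x, ‖f x‖ ^ 2 ∂μ := by positivity
  rw [hf.eLpNorm_eq_integral_rpow_norm two_ne_zero ENNReal.ofNat_ne_top]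
  simp only [ENNReal.toReal_ofNat, Real.rpow_two]
  rw [ENNReal.toReal_ofReal (by positivity), ← Real.rpow_natCast, ← Real.rpow_mul h0]
  norm_num

theorem hasSum_sq_norm_fourierCoef {f : ℝ → ℂ} (hf : MemLp f 2 μ₀) :
    HasSum (fun n => ‖fourierCoef f n‖ ^ 2) ((2 * π)⁻¹ * (eLpNorm f 2 μ₀).toReal ^ 2) := by
  have hle : -π ≤ π := (neg_lt_self Real.pi_pos).le
  have hf' : MemLp f 2 (volume.restrict (Set.Ioc (-π) π)) := by
    rwa [Measure.restrict_congr_set Ioo_ae_eq_Ioc] at hf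
  have h := hasSum_sq_fourierCoeffOn (neg_lt_self Real.pi_pos) hf'
  simp_rw [← fourierCoef_eq_fourierCoeffOn] at h
  rwa [intervalIntegral.integral_of_le hle, integral_Ioc_eq_integral_Ioo,
    integral_norm_sq_eq_toReal_eLpNorm_two hf, smul_eq_mul, sub_neg_eq_add, ← two_mul] at h

theorem integrable_mul_exp {g : ℝ → ℂ} (hg : Integrable g μ₀) (n : ℤ) :
    Integrable (fun x : ℝ => g x * Complex.exp (-(Complex.I * n * x))) μ₀ := by
  refine hg.mul_bdd (c := 1) (Continuous.aestronglyMeasurable (by fun_prop))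
    (ae_of_all _ fun x => ?_)
  simp [Complex.norm_exp]

theorem fourierCoef_eq_setIntegral (f : ℝ → ℂ) (n : ℤ) :
    fourierCoef f n = (1 / (2 * π)) * ∫ x, f x * Complex.exp (-(Complex.I * n * x)) ∂μ₀ := by
  rw [fourierCoef, intervalIntegral.integral_of_le (neg_lt_self Real.pi_pos).le,
    integral_Ioc_eq_integral_Ioo]

theorem fourierCoef_sub {f g : ℝ → ℂ} (hf : Integrable f μ₀) (hg : Integrable g μ₀) (n : ℤ) :
    fourierCoef (fun x => f x - g x) n = fourierCoef f n - fourierCoef g n := by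
  simp_rw [fourierCoef_eq_setIntegral, sub_mul]
  rw [integral_sub (integrable_mul_exp hf n) (integrable_mul_exp hg n), mul_sub]

theorem norm_fourierCoef_le_s17 (g : ℝ → ℂ) (n : ℤ) :
    ‖fourierCoef g n‖ ≤ (2 * π)⁻¹ * ∫ x, ‖g x‖ ∂μ₀ := by
  rw [fourierCoef_eq_setIntegral, norm_mul]
  have h1 : ‖(1 / (2 * π) : ℂ)‖ = (2 * π)⁻¹ := by
    simp [abs_of_pos Real.pi_pos]
  rw [h1]
  gcongr
  refine (norm_integral_le_integral_norm _).trans_eq ?_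
  congr with x
  simp [Complex.norm_exp]

theorem fourierCoef_exp (m n : ℤ) :
    fourierCoef (fun x => Complex.exp (Complex.I * m * x)) n = if m = n then 1 else 0 := by
  have hπ : (π : ℂ) ≠ 0 := by exact_mod_cast Real.pi_ne_zero
  rw [fourierCoef]
  have h : ∀ x : ℝ, Complex.exp (Complex.I * m * x) * Complex.exp (-(Complex.I * n * x)) =
      Complex.exp (Complex.I * ((m - n : ℤ) : ℂ) * x) := fun x => by
    rw [← Complex.exp_add]; push_cast; ring_nf
  simp_rw [h]
  split_ifs with hmn
  · subst hmn
    simp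
    field_simp
    ring
  · have hne : (Complex.I * ((m - n : ℤ) : ℂ)) ≠ 0 :=
      mul_ne_zero Complex.I_ne_zero (by exact_mod_cast sub_ne_zero.2 hmn)
    rw [integral_exp_mul_complex hne]
    have hper : Complex.exp (Complex.I * ((m - n : ℤ) : ℂ) * (π : ℝ)) =
        Complex.exp (Complex.I * ((m - n : ℤ) : ℂ) * ((-π : ℝ) : ℂ)) := by
      rw [Complex.exp_eq_exp_iff_exists_int]
      exact ⟨m - n, by push_cast; ring⟩
    rw [hper]
    simp

theorem norm_mul_exp_I_mul (c : ℂ) (n : ℤ) (x : ℝ) :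
    ‖c * Complex.exp (Complex.I * n * x)‖ = ‖c‖ := by
  simp [Complex.norm_exp]

theorem summable_mul_exp {c : ℤ → ℂ} (hc : Summable fun n => ‖c n‖) (x : ℝ) :
    Summable fun n : ℤ => c n * Complex.exp (Complex.I * n * x) :=
  hc.of_norm_bounded fun _ => (norm_mul_exp_I_mul _ _ _).le

theorem continuous_tsum_mul_exp {c : ℤ → ℂ} (hc : Summable fun n => ‖c n‖) :
    Continuous fun x : ℝ => ∑' n : ℤ, c n * Complex.exp (Complex.I * n * x) :=
  continuous_tsum (fun n => by fun_prop) hc fun _ _ => (norm_mul_exp_I_mul _ _ _).le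

theorem fourierCoef_tsum_mul_exp {c : ℤ → ℂ} (hc : Summable fun n => ‖c n‖) (n : ℤ) :
    fourierCoef (fun x => ∑' m : ℤ, c m * Complex.exp (Complex.I * m * x)) n = c n := by
  have hs : ∀ x : ℝ, HasSum (fun m : ℤ => c m * Complex.exp (Complex.I * m * x) *
      Complex.exp (-(Complex.I * n * x)))
      ((∑' m : ℤ, c m * Complex.exp (Complex.I * m * x)) * Complex.exp (-(Complex.I * n * x))) :=
    fun x => (summable_mul_exp hc x).hasSum.mul_right _
  have h := hasSum_integral_of_dominated_convergence (μ := μ₀) (fun m _ => ‖c m‖)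
    (F := fun m (x : ℝ) => c m * Complex.exp (Complex.I * m * x) *
      Complex.exp (-(Complex.I * n * x)))
    (fun m => Continuous.aestronglyMeasurable (by fun_prop))
    (fun m => ae_of_all _ fun x => by simp [Complex.norm_exp])
    (ae_of_all _ fun _ => hc) (by simp) (ae_of_all _ hs)
  have h2 := h.mul_left (1 / (2 * π) : ℂ)
  rw [← fourierCoef_eq_setIntegral] at h2
  have hterm : ∀ m : ℤ, (1 / (2 * π) : ℂ) * ∫ x, c m * Complex.exp (Complex.I * m * x) *
      Complex.exp (-(Complex.I * n * x)) ∂μ₀ = if m = n then c n else 0 := fun m => by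
    simp_rw [mul_assoc (c m)]
    rw [integral_const_mul, mul_left_comm,
      ← fourierCoef_eq_setIntegral (fun x => Complex.exp (Complex.I * m * x)), fourierCoef_exp]
    split_ifs with hmn <;> simp [hmn]
  simp_rw [hterm] at h2
  exact h2.unique (hasSum_ite_eq n (c n))

theorem summable_exp_neg_sq_mul {t : ℝ} (ht : 0 < t) :
    Summable fun n : ℤ => Real.exp (-((n : ℝ) ^ 2 * t)) := by
  convert summable_pow_mul_jacobiTheta₂_term_bound 0 (div_pos ht Real.pi_pos) 0 using 2 with n
  simp only [pow_zero, one_mul]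
  congr 1
  field_simp
  ring

theorem norm_fourierCoef_le_eLpNorm_two {f : ℝ → ℂ} (hf : MemLp f 2 μ₀) (n : ℤ) :
    ‖fourierCoef f n‖ ≤ (eLpNorm f 2 μ₀).toReal := by
  refine (pow_le_pow_iff_left₀ (norm_nonneg _) ENNReal.toReal_nonneg two_ne_zero).1 ?_
  refine (le_hasSum (hasSum_sq_norm_fourierCoef hf) n fun _ _ => by positivity).trans ?_
  refine mul_le_of_le_one_left (by positivity) (inv_le_one_of_one_le₀ ?_)
  linarith [Real.pi_gt_three]

theorem norm_heatOp_coef (tb : ℝ) (f : ℝ → ℂ) (n : ℤ) :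
    ‖(Real.exp (-((n : ℝ) ^ 2 * tb)) : ℂ) * fourierCoef f n‖ =
      Real.exp (-((n : ℝ) ^ 2 * tb)) * ‖fourierCoef f n‖ := by
  rw [norm_mul, Complex.norm_real, Real.norm_of_nonneg (Real.exp_nonneg _)]

theorem summable_heatOp_coef {tb : ℝ} (htb : 0 < tb) {f : ℝ → ℂ} (hf : MemLp f 2 μ₀) :
    Summable fun n : ℤ => ‖(Real.exp (-((n : ℝ) ^ 2 * tb)) : ℂ) * fourierCoef f n‖ := by
  refine .of_nonneg_of_le (fun _ => norm_nonneg _) (fun n => ?_)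
    ((summable_exp_neg_sq_mul htb).mul_right (eLpNorm f 2 μ₀).toReal)
  rw [norm_heatOp_coef]
  gcongr
  exact norm_fourierCoef_le_eLpNorm_two hf n

theorem continuous_heatOp {tb : ℝ} (htb : 0 < tb) {f : ℝ → ℂ} (hf : MemLp f 2 μ₀) :
    Continuous (heatOp tb f) :=
  continuous_tsum_mul_exp (summable_heatOp_coef htb hf)

theorem integrable_heatOp {tb : ℝ} (htb : 0 < tb) {f : ℝ → ℂ} (hf : MemLp f 2 μ₀) :
    Integrable (heatOp tb f) μ₀ :=
  ((continuous_heatOp htb hf).integrableOn_Icc (a := -π) (b := π)).mono_set Set.Ioo_subset_Icc_self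

theorem fourierCoef_heatOp {tb : ℝ} (htb : 0 < tb) {f : ℝ → ℂ} (hf : MemLp f 2 μ₀) (n : ℤ) :
    fourierCoef (heatOp tb f) n = (Real.exp (-((n : ℝ) ^ 2 * tb)) : ℂ) * fourierCoef f n :=
  fourierCoef_tsum_mul_exp (summable_heatOp_coef htb hf) n

theorem heatOp_sub {tb : ℝ} (htb : 0 < tb) {f g : ℝ → ℂ} (hf : MemLp f 2 μ₀)
    (hg : MemLp g 2 μ₀) (x : ℝ) :
    heatOp tb (fun y => f y - g y) x = heatOp tb f x - heatOp tb g x := by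
  simp_rw [heatOp]
  rw [← (summable_mul_exp (summable_heatOp_coef htb hf) x).tsum_sub
    (summable_mul_exp (summable_heatOp_coef htb hg) x)]
  congr with n
  rw [fourierCoef_sub (hf.integrable one_le_two) (hg.integrable one_le_two)]
  ring

/-- The `n`-th coefficient of `f` is controlled by the `L¹` norm of `T f`. -/
theorem exp_mul_norm_fourierCoef_le {tb : ℝ} (htb : 0 < tb) {f : ℝ → ℂ} (hf : MemLp f 2 μ₀)
    (n : ℤ) :
    Real.exp (-((n : ℝ) ^ 2 * tb)) * ‖fourierCoef f n‖ ≤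
      (2 * π)⁻¹ * ∫ x, ‖heatOp tb f x‖ ∂μ₀ := by
  rw [← norm_heatOp_coef, ← fourierCoef_heatOp htb hf]
  exact norm_fourierCoef_le_s17 _ _

theorem hasSum_indicator_Icc_neg (N : ℕ) (b : ℝ) :
    HasSum (fun n : ℤ => if n ∈ Finset.Icc (-(N : ℤ)) N then b else 0) ((2 * N + 1) * b) := by
  have h := hasSum_sum_of_ne_finset_zero (s := Finset.Icc (-(N : ℤ)) N)
    (f := fun n : ℤ => if n ∈ Finset.Icc (-(N : ℤ)) N then b else 0) (L := .unconditional ℤ)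
    fun n hn => if_neg hn
  rw [Finset.sum_ite_mem, Finset.inter_self, Finset.sum_const, Int.card_Icc, nsmul_eq_mul] at h
  convert h using 2
  rw [show (N : ℤ) + 1 - -N = ((2 * N + 1 : ℕ) : ℤ) by push_cast; ring, Int.toNat_natCast]
  push_cast
  ring

theorem sq_succ_le_sq_of_notMem_Icc {N : ℕ} {n : ℤ} (hn : n ∉ Finset.Icc (-(N : ℤ)) N) :
    ((N : ℝ) + 1) ^ 2 ≤ (n : ℝ) ^ 2 := by
  have : ((N : ℤ) + 1) ^ 2 ≤ n ^ 2 := by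
    rw [Finset.mem_Icc, not_and_or, not_le, not_le] at hn
    rcases hn with h | h <;> nlinarith
  exact_mod_cast this

theorem sq_le_sq_of_mem_Icc {N : ℕ} {n : ℤ} (hn : n ∈ Finset.Icc (-(N : ℤ)) N) :
    (n : ℝ) ^ 2 ≤ (N : ℝ) ^ 2 := by
  have : n ^ 2 ≤ (N : ℤ) ^ 2 := by
    rw [Finset.mem_Icc] at hn
    nlinarith
  exact_mod_cast this

/-- Interpolation of the sup norm of `T f` between its `L¹` norm and the `L²` norm of `f`. -/
theorem norm_heatOp_le {tb : ℝ} (htb : 0 < tb) {f : ℝ → ℂ} (hf : MemLp f 2 μ₀) (N : ℕ) (x : ℝ) :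
    ‖heatOp tb f x‖ ≤ (2 * N + 1) * ((2 * π)⁻¹ * ∫ x, ‖heatOp tb f x‖ ∂μ₀) +
      Real.exp (-(3 / 4 * (N + 1) ^ 2 * tb)) * (eLpNorm f 2 μ₀).toReal *
        ∑' n : ℤ, Real.exp (-((n : ℝ) ^ 2 * (tb / 4))) := by
  set b := (2 * π)⁻¹ * ∫ x, ‖heatOp tb f x‖ ∂μ₀ with hb
  have hb0 : 0 ≤ b := by positivity
  refine tsum_of_norm_bounded ((hasSum_indicator_Icc_neg N b).add
    ((summable_exp_neg_sq_mul (by positivity : 0 < tb / 4)).hasSum.mul_left _)) fun n => ?_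
  rw [norm_mul_exp_I_mul, norm_heatOp_coef]
  split_ifs with hn
  · exact (exp_mul_norm_fourierCoef_le htb hf n).trans (le_add_of_nonneg_right (by positivity))
  · have h1 : Real.exp (-((n : ℝ) ^ 2 * tb)) ≤
        Real.exp (-(3 / 4 * (N + 1) ^ 2 * tb)) * Real.exp (-((n : ℝ) ^ 2 * (tb / 4))) := by
      rw [← Real.exp_add, Real.exp_le_exp]
      nlinarith [mul_le_mul_of_nonneg_right (sq_succ_le_sq_of_notMem_Icc hn) htb.le]
    rw [zero_add, mul_right_comm]
    exact mul_le_mul h1 (norm_fourierCoef_le_eLpNorm_two hf n) (norm_nonneg _) (by positivity)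

/-- The variational source condition for `f† ∈ H^p`, with free cut-off frequency `K`. -/
theorem sq_norm_sub_le_of_sobolev {tb p : ℝ} (htb : 0 < tb) (hp : 0 < p) {f g : ℝ → ℂ}
    (hf : MemLp f 2 μ₀) (hg : MemLp g 2 μ₀)
    (hS : Summable fun n : ℤ => (1 + (n : ℝ) ^ 2) ^ p * ‖fourierCoef g n‖ ^ 2) (K : ℕ) :
    3 / 4 * (eLpNorm (fun x => f x - g x) 2 μ₀).toReal ^ 2 ≤
      (eLpNorm f 2 μ₀).toReal ^ 2 - (eLpNorm g 2 μ₀).toReal ^ 2 +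
      2 * (2 * K + 1) * (eLpNorm g 2 μ₀).toReal * Real.exp ((K : ℝ) ^ 2 * tb) *
        (∫ x, ‖heatOp tb (fun x => f x - g x) x‖ ∂μ₀) +
      8 * π * (((K : ℝ) + 1) ^ 2) ^ (-p) *
        ∑' n : ℤ, (1 + (n : ℝ) ^ 2) ^ p * ‖fourierCoef g n‖ ^ 2 := by
  have hh : MemLp (fun x => f x - g x) 2 μ₀ := hf.sub hg
  set h := fun x => f x - g x with hdef
  set B := ∫ x, ‖heatOp tb h x‖ ∂μ₀ with hB
  set F := (eLpNorm g 2 μ₀).toReal with hF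
  have hB0 : 0 ≤ B := by positivity
  have hcoef : ∀ n, fourierCoef f n = fourierCoef h n + fourierCoef g n := fun n => by
    rw [hdef, fourierCoef_sub (hf.integrable one_le_two) (hg.integrable one_le_two)]
    ring
  have hL := ((hasSum_sq_norm_fourierCoef hh).add (hasSum_sq_norm_fourierCoef hg)).sub
    (hasSum_sq_norm_fourierCoef hf)
  have hR := ((hasSum_indicator_Icc_neg K
    (2 * F * Real.exp ((K : ℝ) ^ 2 * tb) * ((2 * π)⁻¹ * B))).add
    ((hasSum_sq_norm_fourierCoef hh).mul_left (1 / 4))).add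
    (hS.hasSum.mul_left (4 * (((K : ℝ) + 1) ^ 2) ^ (-p)))
  have key := hasSum_le (fun n => ?_) hL hR
  · have h2 := mul_le_mul_of_nonneg_left key (by positivity : 0 ≤ 2 * π)
    field_simp at h2 ⊢
    linarith
  have hsq : ‖fourierCoef h n‖ ^ 2 + ‖fourierCoef g n‖ ^ 2 - ‖fourierCoef f n‖ ^ 2 ≤
      2 * ‖fourierCoef g n‖ * ‖fourierCoef h n‖ := by
    have h1 : |‖fourierCoef h n‖ - ‖fourierCoef g n‖| ≤ ‖fourierCoef f n‖ := by
      rw [hcoef]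
      simpa using abs_norm_sub_norm_le (fourierCoef h n) (-fourierCoef g n)
    have h2 := pow_le_pow_left₀ (abs_nonneg _) h1 2
    rw [sq_abs] at h2
    linarith
  refine hsq.trans ?_
  split_ifs with hn
  · have h1 : ‖fourierCoef h n‖ ≤ Real.exp ((K : ℝ) ^ 2 * tb) * ((2 * π)⁻¹ * B) := by
      have h2 := exp_mul_norm_fourierCoef_le htb hh n
      rw [Real.exp_neg, inv_mul_le_iff₀ (Real.exp_pos _)] at h2
      exact h2.trans (mul_le_mul_of_nonneg_right (Real.exp_le_exp.2
        (mul_le_mul_of_nonneg_right (sq_le_sq_of_mem_Icc hn) htb.le)) (by positivity))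
    have h3 : 2 * ‖fourierCoef g n‖ * ‖fourierCoef h n‖ ≤
        2 * F * (Real.exp ((K : ℝ) ^ 2 * tb) * ((2 * π)⁻¹ * B)) := by
      gcongr
      exact norm_fourierCoef_le_eLpNorm_two hg n
    have h4 : 0 ≤ 4 * (((K : ℝ) + 1) ^ 2) ^ (-p) *
        ((1 + (n : ℝ) ^ 2) ^ p * ‖fourierCoef g n‖ ^ 2) := by positivity
    nlinarith [sq_nonneg ‖fourierCoef h n‖]
  · have h1 : 1 ≤ (((K : ℝ) + 1) ^ 2) ^ (-p) * (1 + (n : ℝ) ^ 2) ^ p := by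
      rw [Real.rpow_neg (by positivity), ← div_eq_inv_mul, one_le_div (by positivity)]
      refine Real.rpow_le_rpow (by positivity) ?_ hp.le
      linarith [sq_succ_le_sq_of_notMem_Icc hn]
    have h2 := mul_le_mul_of_nonneg_right h1 (sq_nonneg ‖fourierCoef g n‖)
    nlinarith [sq_nonneg (‖fourierCoef h n‖ / 2 - 2 * ‖fourierCoef g n‖)]

/-- Impulsive noise: outside the corrupted set `s` the noise is small, and on `s` only the sup norm
of `u` enters. -/
theorem integral_norm_sub_integral_norm_sub_ge {X : Type*} [MeasurableSpace X] {μ : Measure X}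
    [IsFiniteMeasure μ] [Nonempty X] {u ξ : X → ℂ} (hu : Integrable u μ)
    (hξ : Integrable ξ μ) {s : Set X}
    (hs : MeasurableSet s) {M ε η : ℝ} (hM : ∀ x, ‖u x‖ ≤ M) (hε : 0 ≤ ε) (hη : 0 ≤ η)
    (hξε : eLpNorm ξ 1 (μ.restrict sᶜ) ≤ ENNReal.ofReal ε) (hsη : μ s ≤ ENNReal.ofReal η) :
    ∫ x, ‖u x‖ ∂μ - 2 * ε - 2 * η * M ≤ ∫ x, ‖u x - ξ x‖ ∂μ - ∫ x, ‖ξ x‖ ∂μ := by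
  have hM0 : 0 ≤ M := (norm_nonneg _).trans (hM (Classical.arbitrary X))
  have hi1 : Integrable (sᶜ.indicator fun x => 2 * ‖ξ x‖) μ :=
    (hξ.norm.const_mul 2).indicator hs.compl
  have hi2 : Integrable (s.indicator fun _ => 2 * M) μ := (integrable_const _).indicator hs
  have hi3 : Integrable (fun x => ‖u x - ξ x‖) μ := (hu.sub hξ).norm
  have hi12 : Integrable (fun x => sᶜ.indicator (fun x => 2 * ‖ξ x‖) x +
      s.indicator (fun _ => 2 * M) x) μ := hi1.add hi2
  have hpt : ∀ x, ‖u x‖ + ‖ξ x‖ ≤ ‖u x - ξ x‖ + (sᶜ.indicator (fun x => 2 * ‖ξ x‖) x +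
      s.indicator (fun _ => 2 * M) x) := fun x => by
    by_cases hx : x ∈ s
    · have := norm_sub_norm_le (ξ x) (u x)
      rw [norm_sub_rev] at this
      simp only [Set.indicator, hx, Set.mem_compl_iff, not_true_eq_false, if_true, if_false]
      linarith [hM x]
    · have := norm_sub_norm_le (u x) (ξ x)
      simp only [Set.indicator, hx, Set.mem_compl_iff, not_false_eq_true, if_true, if_false]
      linarith
  have h := integral_mono (hu.norm.add hξ.norm) (hi3.add hi12) hpt
  simp only [Pi.add_apply] at h
  rw [integral_add hu.norm hξ.norm, integral_add hi3 hi12,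
    integral_add hi1 hi2, integral_indicator hs.compl, integral_indicator hs, integral_const_mul,
    integral_norm_eq_toReal_eLpNorm_one hξ.1.restrict, setIntegral_const, smul_eq_mul] at h
  have h1 := ENNReal.toReal_le_of_le_ofReal hε hξε
  have h2 : μ.real s ≤ η := ENNReal.toReal_le_of_le_ofReal hη hsη
  nlinarith [mul_le_mul_of_nonneg_right h2 hM0]

theorem exists_noise_cutoff {tb η : ℝ} (htb : 0 < tb) (hη : 0 < η) (hη₀ : η ≤ 1 / 5) :
    ∃ N : ℕ, 3 * η * ((2 * N + 1) * (2 * π)⁻¹) ≤ 1 ∧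
      Real.exp (-(3 / 4 * (N + 1) ^ 2 * tb)) ^ 2 ≤ Real.exp (-(π ^ 2 * tb) / (8 * η ^ 2)) := by
  have hπ := Real.pi_gt_three
  set y := π / η with hy
  have hyη : y * η = π := by rw [hy]; field_simp
  have hy15 : 15 ≤ y := by
    rw [hy, le_div_iff₀ hη]; linarith
  refine ⟨⌊y / 3 - 1 / 2⌋₊, ?_, ?_⟩
  · have h1 := Nat.floor_le (by linarith : 0 ≤ y / 3 - 1 / 2)
    have h2 : 3 * η * (2 * (⌊y / 3 - 1 / 2⌋₊ : ℝ) + 1) ≤ 2 * π := by nlinarith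
    rw [← mul_assoc, ← div_eq_mul_inv, div_le_one (by positivity)]
    exact h2
  · have h1 := (Nat.lt_floor_add_one (y / 3 - 1 / 2)).le
    set N : ℝ := (⌊y / 3 - 1 / 2⌋₊ : ℝ)
    have h2 : (3 / 10 * y) ^ 2 ≤ (N + 1) ^ 2 := by
      gcongr
      linarith
    have h3 : -(π ^ 2 * tb) / (8 * η ^ 2) = -(y ^ 2 * tb / 8) := by
      rw [hy]; field_simp
    rw [← Real.exp_nat_mul, h3, Real.exp_le_exp]
    push_cast
    nlinarith [mul_le_mul_of_nonneg_right h2 htb.le, mul_nonneg (sq_nonneg y) htb.le]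

theorem exists_smoothness_cutoff {tb p F α : ℝ} (htb : 0 < tb) (hp : 0 < p) (hF : 0 ≤ F)
    (hα : 0 < α) (hL : 1 + 96 * F * (1 / tb + 3) ≤ -Real.log α) :
    ∃ K : ℕ, 2 * (2 * K + 1) * F * Real.exp ((K : ℝ) ^ 2 * tb) ≤ 1 / 6 * (1 / α) ∧
      (((K : ℝ) + 1) ^ 2) ^ (-p) ≤ (2 * tb) ^ p * (-Real.log α) ^ (-p) := by
  set L := -Real.log α with hLdef
  have hL1 : 1 ≤ L := (le_add_of_nonneg_right (by positivity)).trans hL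
  have hLpos : 0 < L := by linarith
  have hαE : 1 / α = Real.exp (L / 2) * Real.exp (L / 2) := by
    rw [← Real.exp_add, add_halves, hLdef, Real.exp_neg, Real.exp_log hα, one_div]
  set q := L / (2 * tb) with hq
  have hq0 : 0 < q := by positivity
  have hqt : q * tb = L / 2 := by rw [hq]; field_simp
  refine ⟨⌊√q⌋₊, ?_, ?_⟩
  · have h1 := Nat.floor_le (Real.sqrt_nonneg q)
    set K : ℝ := (⌊√q⌋₊ : ℝ) with hK
    have hK0 : 0 ≤ K := Nat.cast_nonneg _
    have h2 : K ^ 2 ≤ q := by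
      rw [← Real.sq_sqrt hq0.le]
      gcongr
    have h3 : K ≤ q + 1 := by nlinarith
    have h4 : Real.exp (K ^ 2 * tb) ≤ Real.exp (L / 2) := by
      rw [← hqt]; gcongr
    have h5 : 12 * (2 * K + 1) * F ≤ Real.exp (L / 2) := by
      have h6 := Real.quadratic_le_exp_of_nonneg (by positivity : 0 ≤ L / 2)
      have h7 : 2 * q = L * (1 / tb) := by rw [hq]; field_simp
      have h8 : 2 * K + 1 ≤ L * (1 / tb + 3) := by nlinarith
      have h9 := mul_le_mul_of_nonneg_right h8 hF
      have h10 := mul_le_mul_of_nonneg_left hL hLpos.le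
      nlinarith
    rw [hαE]
    have h11 : 2 * (2 * K + 1) * F ≤ 1 / 6 * Real.exp (L / 2) := by linarith
    calc 2 * (2 * K + 1) * F * Real.exp (K ^ 2 * tb)
        ≤ 1 / 6 * Real.exp (L / 2) * Real.exp (L / 2) :=
          mul_le_mul h11 h4 (Real.exp_nonneg _) (by positivity)
      _ = _ := by ring
  · have h1 := (Nat.lt_floor_add_one (√q)).le
    have h2 : q ≤ ((⌊√q⌋₊ : ℝ) + 1) ^ 2 := by
      rw [← Real.sq_sqrt hq0.le]
      gcongr
      rwa [Real.sq_sqrt hq0.le]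
    calc (((⌊√q⌋₊ : ℝ) + 1) ^ 2) ^ (-p) ≤ q ^ (-p) :=
          Real.rpow_le_rpow_of_nonpos hq0 h2 (by linarith)
      _ = (2 * tb) ^ p * L ^ (-p) := by
          rw [hq, Real.div_rpow hLpos.le (by positivity), Real.rpow_neg (by positivity : 0 ≤ 2 * tb)]
          field_simp

/-- Combines the variational source condition (`hsob`), the noise bound (`hnoise`) and minimality
(`hmin`), where `a` is the `L²` error, `B` the `L¹` image-space error, `u` and `v` are the `L¹`
norms of residual and noise, and `W`, `F` are the `L²` norms of estimator and exact solution. -/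
theorem rate_of_basic_inequalities {α η ε a B S M P Λ E G W F c₁ c₂ r u v : ℝ} (hα : 0 < α)
    (hη : 0 < η) (hε : 0 ≤ ε) (hB : 0 ≤ B) (hM : 0 ≤ M)
    (hP : 0 ≤ P) (hΛ : 0 ≤ Λ) (hc₁ : 3 * η * (c₁ * (2 * π)⁻¹) ≤ 1) (hG : G ^ 2 ≤ E)
    (hc₂ : c₂ ≤ 1 / 6 * (1 / α)) (hr : r ≤ P * Λ)
    (hsob : 3 / 4 * a ^ 2 ≤ W ^ 2 - F ^ 2 + c₂ * B + 8 * π * r * M)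
    (hnoise : B - 2 * ε - 2 * η * (c₁ * ((2 * π)⁻¹ * B) + G * a * S) ≤ u - v)
    (hmin : 1 / α * u + W ^ 2 ≤ 1 / α * v + F ^ 2) :
    a ^ 2 ≤ 6 * (2 + 4 * S ^ 2 + 8 * π * M * P) * (ε / α + η ^ 2 / α ^ 2 * E + Λ) ∧
      B ≤ 6 * (2 + 4 * S ^ 2 + 8 * π * M * P) * (ε + η ^ 2 / α * E + α * Λ) := by
  have hE : 0 ≤ E := (sq_nonneg G).trans hG
  have hβ : 0 < 1 / α := by positivity
  have h1 : B / 3 - 2 * ε - 2 * η * G * a * S ≤ u - v := by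
    have := mul_le_mul_of_nonneg_right hc₁ hB
    linarith
  have h2 := mul_le_mul_of_nonneg_left h1 hβ.le
  have h3 := mul_le_mul_of_nonneg_right hc₂ hB
  have h4 : 8 * π * r * M ≤ 8 * π * M * P * Λ := by
    have := mul_le_mul_of_nonneg_left hr (by positivity : 0 ≤ 8 * π * M)
    linarith
  have h5 : 1 / α * (2 * η * G * a * S) ≤ a ^ 2 / 4 + 4 * S ^ 2 * (η ^ 2 / α ^ 2 * E) := by
    have h6 : 4 * S ^ 2 * (η ^ 2 / α ^ 2 * G ^ 2) ≤ 4 * S ^ 2 * (η ^ 2 / α ^ 2 * E) := by gcongr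
    have h7 : 4 * S ^ 2 * (η ^ 2 / α ^ 2 * G ^ 2) = (2 * (1 / α * η * G * S)) ^ 2 := by
      field_simp
      ring
    nlinarith [sq_nonneg (a / 2 - 2 * (1 / α * η * G * S))]
  set Q := ε / α + η ^ 2 / α ^ 2 * E + Λ with hQ
  have hεα : 0 ≤ ε / α := by positivity
  have hηα : 0 ≤ η ^ 2 / α ^ 2 * E := by positivity
  have hC : 2 * (1 / α * ε) + 4 * S ^ 2 * (η ^ 2 / α ^ 2 * E) + 8 * π * M * P * Λ ≤
      (2 + 4 * S ^ 2 + 8 * π * M * P) * Q := by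
    have e1 : 1 / α * ε ≤ Q := by rw [one_div_mul_eq_div]; linarith
    have e2 : η ^ 2 / α ^ 2 * E ≤ Q := by linarith
    have e3 : Λ ≤ Q := by linarith
    have := mul_le_mul_of_nonneg_left e2 (by positivity : 0 ≤ 4 * S ^ 2)
    have := mul_le_mul_of_nonneg_left e3 (by positivity : 0 ≤ 8 * π * M * P)
    linarith
  have hmain : a ^ 2 / 2 + 1 / α * B / 6 ≤ (2 + 4 * S ^ 2 + 8 * π * M * P) * Q := by
    linarith
  have hBα : 0 ≤ 1 / α * B := by positivity
  refine ⟨by linarith [sq_nonneg a], ?_⟩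
  have h8 : 1 / α * B ≤ 6 * (2 + 4 * S ^ 2 + 8 * π * M * P) * Q := by linarith [sq_nonneg a]
  have h9 := mul_le_mul_of_nonneg_left h8 hα.le
  have h10 : α * (1 / α * B) = B := by field_simp
  have h11 : α * Q = ε + η ^ 2 / α * E + α * Λ := by
    rw [hQ]; field_simp
  calc B = α * (1 / α * B) := h10.symm
    _ ≤ α * (6 * (2 + 4 * S ^ 2 + 8 * π * M * P) * Q) := h9
    _ = 6 * (2 + 4 * S ^ 2 + 8 * π * M * P) * (α * Q) := by ring
    _ = _ := by rw [h11]

/-- Convergence rates for Tikhonov regularization of the periodic backwards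
heat equation under impulsive noise (Theorem 4.2): if `f† ∈ H^p(-π,π)` and the regularization
parameter satisfies `√(2ε/α) + 2ηγ(2η)/α ≤ C_e`, then
`‖f̂_α - f†‖²_{L²} ≤ C (ε/α + (η²/α²) e^{-π²t̄/(8η²)} + (-ln α)^{-p})` and
`‖Tf̂_α - g†‖_{L¹} ≤ C (ε + (η²/α) e^{-π²t̄/(8η²)} + α(-ln α)^{-p})`. -/
theorem heat_tikhonov_convergence_rates (tb p : ℝ) (htb : 0 < tb) (hp : 0 < p)
    (fdag : ℝ → ℂ) (hfdag : MemLp fdag 2 (volume.restrict (Set.Ioo (-π) π)))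
    -- Sobolev smoothness `f† ∈ H^p(-π,π)`
    (hSobolev : Summable (fun n : ℤ =>
      (1 + (n : ℝ) ^ 2) ^ p * ‖fourierCoef fdag n‖ ^ 2))
    (C_e : ℝ) :
    ∃ (η₀ ε₀ α₀ C : ℝ), 0 < η₀ ∧ 0 < ε₀ ∧ 0 < α₀ ∧ 0 < C ∧
      ∀ (η ε α : ℝ), 0 < η → η ≤ η₀ → 0 ≤ ε → ε ≤ ε₀ → 0 < α → α ≤ α₀ →
      -- the noise
      ∀ (ξ : ℝ → ℂ), AEStronglyMeasurable ξ (volume.restrict (Set.Ioo (-π) π)) →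
        eLpNorm ξ 1 (volume.restrict (Set.Ioo (-π) π)) ≠ ⊤ →
      ∀ (gobs : ℝ → ℂ), (∀ x, gobs x = heatOp tb fdag x + ξ x) →
      ∀ (Mc : Set ℝ), MeasurableSet Mc → Mc ⊆ Set.Ioo (-π) π →
        eLpNorm ξ 1 (volume.restrict (Set.Ioo (-π) π \ Mc)) ≤ ENNReal.ofReal ε →
        volume Mc ≤ ENNReal.ofReal η →
      -- the parameter choice condition (2.7)
      Real.sqrt (2 * ε / α) +
          2 * η * ((8 * max 1 (tb ^ (-(1 : ℝ) / 2)) / (Real.exp (3 * tb) - 1)) *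
            Real.exp (-(((⌊π / (2 * η) - 1 / 2⌋ : ℤ) : ℝ) ^ 2 * tb))) / α ≤ C_e →
      -- the Tikhonov estimator
      ∀ (fhat : ℝ → ℂ), MemLp fhat 2 (volume.restrict (Set.Ioo (-π) π)) →
        (∀ f : ℝ → ℂ, MemLp f 2 (volume.restrict (Set.Ioo (-π) π)) →
          ENNReal.ofReal (1 / α) *
              eLpNorm (fun x => heatOp tb fhat x - gobs x) 1 (volume.restrict (Set.Ioo (-π) π))
              + ENNReal.ofReal
                  ((eLpNorm fhat 2 (volume.restrict (Set.Ioo (-π) π))).toReal ^ 2)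
            ≤ ENNReal.ofReal (1 / α) *
                eLpNorm (fun x => heatOp tb f x - gobs x) 1 (volume.restrict (Set.Ioo (-π) π))
              + ENNReal.ofReal
                  ((eLpNorm f 2 (volume.restrict (Set.Ioo (-π) π))).toReal ^ 2)) →
        (eLpNorm (fun x => fhat x - fdag x) 2 (volume.restrict (Set.Ioo (-π) π))).toReal ^ 2
            ≤ C * (ε / α + η ^ 2 / α ^ 2 * Real.exp (-(π ^ 2 * tb) / (8 * η ^ 2))
                + (-Real.log α) ^ (-p)) ∧
        (eLpNorm (fun x => heatOp tb fhat x - heatOp tb fdag x) 1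
              (volume.restrict (Set.Ioo (-π) π))).toReal
            ≤ C * (ε + η ^ 2 / α * Real.exp (-(π ^ 2 * tb) / (8 * η ^ 2))
                + α * (-Real.log α) ^ (-p)) := by
  set F := (eLpNorm fdag 2 μ₀).toReal with hF
  set S := ∑' n : ℤ, Real.exp (-((n : ℝ) ^ 2 * (tb / 4))) with hS
  set M := ∑' n : ℤ, (1 + (n : ℝ) ^ 2) ^ p * ‖fourierCoef fdag n‖ ^ 2 with hM
  have hF0 : 0 ≤ F := ENNReal.toReal_nonneg
  have hM0 : 0 ≤ M := tsum_nonneg fun n => by positivity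
  set L₀ := 1 + 96 * F * (1 / tb + 3) with hL₀
  have hL₀1 : 1 ≤ L₀ := le_add_of_nonneg_right (by positivity)
  refine ⟨1 / 5, 1, Real.exp (-L₀), 6 * (2 + 4 * S ^ 2 + 8 * π * M * (2 * tb) ^ p),
    by norm_num, one_pos, Real.exp_pos _, by positivity, ?_⟩
  intro η ε α hη hη₀ hε _ hα hα₀ ξ hξm hξ gobs hgobs Mc hMc hMcs hξε hMcη _ fhat hfhat hmin
  have hL : L₀ ≤ -Real.log α := by
    rw [le_neg]
    exact (Real.log_le_iff_le_exp hα).2 hα₀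
  set L := -Real.log α with hLdef
  have hLpos : 0 < L := by linarith
  have hh : MemLp (fun x => fhat x - fdag x) 2 μ₀ := hfhat.sub hfdag
  have hTh : ∀ x, heatOp tb (fun y => fhat y - fdag y) x = heatOp tb fhat x - heatOp tb fdag x :=
    heatOp_sub htb hfhat hfdag
  have hξi : Integrable ξ μ₀ := memLp_one_iff_integrable.1 ⟨hξm, hξ.lt_top⟩
  -- cut-off frequencies
  obtain ⟨N, hN1, hN2⟩ := exists_noise_cutoff htb hη hη₀
  obtain ⟨K, hK1, hK2⟩ := exists_smoothness_cutoff htb hp hF0 hα hL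
  have hsob := sq_norm_sub_le_of_sobolev htb hp hfhat hfdag hSobolev K
  have hsup := norm_heatOp_le htb hh N
  have hnoise := integral_norm_sub_integral_norm_sub_ge (integrable_heatOp htb hh) hξi hMc hsup
    hε hη.le (by rwa [Measure.restrict_restrict hMc.compl, Set.inter_comm, ← Set.sdiff_eq])
    ((Measure.restrict_apply_le _ _).trans hMcη)
  have hB : (eLpNorm (fun x => heatOp tb fhat x - heatOp tb fdag x) 1 μ₀).toReal =
      ∫ x, ‖heatOp tb (fun y => fhat y - fdag y) x‖ ∂μ₀ := by
    rw [integral_norm_eq_toReal_eLpNorm_one (integrable_heatOp htb hh).1]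
    simp_rw [← hTh]
  have hres : ∀ x, heatOp tb fhat x - gobs x = heatOp tb (fun y => fhat y - fdag y) x - ξ x :=
    fun x => by rw [hTh, hgobs]; ring
  have hmin' : 1 / α * (∫ x, ‖heatOp tb (fun y => fhat y - fdag y) x - ξ x‖ ∂μ₀) +
      (eLpNorm fhat 2 μ₀).toReal ^ 2 ≤ 1 / α * (∫ x, ‖ξ x‖ ∂μ₀) + F ^ 2 := by
    have hm := hmin fdag hfdag
    have hdi := (integrable_heatOp htb hh).sub hξi
    have e1 : eLpNorm (fun x => heatOp tb fhat x - gobs x) 1 μ₀ =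
        ENNReal.ofReal (∫ x, ‖heatOp tb (fun y => fhat y - fdag y) x - ξ x‖ ∂μ₀) := by
      simp_rw [hres]
      rw [eLpNorm_one_eq_lintegral_enorm]
      exact (ofReal_integral_norm_eq_lintegral_enorm hdi).symm
    have e2 : eLpNorm (fun x => heatOp tb fdag x - gobs x) 1 μ₀ =
        ENNReal.ofReal (∫ x, ‖ξ x‖ ∂μ₀) := by
      rw [ofReal_integral_norm_eq_lintegral_enorm hξi, eLpNorm_one_eq_lintegral_enorm]
      congr with x
      rw [hgobs, sub_add_cancel_left, enorm_neg]
    rw [e1, e2, ← ENNReal.ofReal_mul (by positivity), ← ENNReal.ofReal_mul (by positivity),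
      ← ENNReal.ofReal_add (by positivity) (by positivity),
      ← ENNReal.ofReal_add (by positivity) (by positivity)] at hm
    exact (ENNReal.ofReal_le_ofReal_iff (by positivity)).1 hm
  rw [hB]
  set B := ∫ x, ‖heatOp tb (fun y => fhat y - fdag y) x‖ ∂μ₀
  have hB0 : 0 ≤ B := by positivity
  exact rate_of_basic_inequalities hα hη hε hB0 hM0 (by positivity) (by positivity) hN1 hN2
    hK1 hK2 hsob hnoise hmin'
end
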